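/- arXiv:2308.07740 — 3 statements merged into one kernel-verified Lean document; each statement's English description precedes it below -/
import Mathlib

section
/- Let d ≥ 1, let k ≥ 2 be an integer, and let s < 0. There exist constants C, δ, K > 0, depending only on d, k, s, such that the following holds. Let (u₀,u₁) be Schwartz functions on ℝ^d with ‖(u₀,u₁)‖_{F⃗L¹} ≤ 1 and ‖(u₀,u₁)‖_{𝓗⁰} ≤ 1, let A ≥ 1, N ≥ A/δ, R > 0, let φ be the function with φ̂ = R·𝟙_{Ω_k}, and set u⃗ := (u₀ + φ, u₁) and φ⃗ := (φ,0). Then for all t with K/N ≤ t ≤ δ: ‖Ξ₁(u⃗)(t) − Ξ₁(φ⃗)(t)‖_{H^s} ≤ C( (t/N) Σ_{m=1}^{k−1} R^m A^{md} + t² ). -/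
open MeasureTheory Real Set Filter Topology
open scoped ENNReal NNReal BigOperators

noncomputable section

/-- Frequency space `ℝ^d` with the Euclidean norm. -/
abbrev Edim (d : ℕ) := EuclideanSpace ℝ (Fin d)

/-! We work entirely on the Fourier side: a function `f` on `ℝ^d` is represented by
its Fourier transform `F = f̂ : ℝ^d → ℂ`. -/

/-- Squared `H^s` norm, computed on the Fourier side:
`‖f‖_{H^s}² = ∫ ⟨ξ⟩^{2s} |f̂(ξ)|² dξ`. -/
def HsNormSq (d : ℕ) (s : ℝ) (F : Edim d → ℂ) : ℝ≥0∞ :=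
  ∫⁻ ξ, ENNReal.ofReal ((1 + ‖ξ‖ ^ 2) ^ s * ‖F ξ‖ ^ 2)

/-- `H^s` norm on the Fourier side. -/
def HsNorm (d : ℕ) (s : ℝ) (F : Edim d → ℂ) : ℝ≥0∞ :=
  HsNormSq d s F ^ (1 / 2 : ℝ)

/-- Norm of `𝓗^s = H^s × H^{s-1}` on the Fourier side. -/
def pairHsNorm (d : ℕ) (s : ℝ) (F G : Edim d → ℂ) : ℝ≥0∞ :=
  (HsNormSq d s F + HsNormSq d (s - 1) G) ^ (1 / 2 : ℝ)

/-- Membership in `H^s`, on the Fourier side. -/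
def MemHs (d : ℕ) (s : ℝ) (F : Edim d → ℂ) : Prop :=
  Measurable F ∧ HsNormSq d s F < ⊤

/-- Membership in `𝓗^s = H^s × H^{s-1}`, on the Fourier side. -/
def MemHsPair (d : ℕ) (s : ℝ) (F G : Edim d → ℂ) : Prop :=
  MemHs d s F ∧ MemHs d (s - 1) G

/-- The Wiener-algebra norm `‖f‖_{FL^{0,1}} = ‖f̂‖_{L¹}`, on the Fourier side. -/
def FLNorm (d : ℕ) (F : Edim d → ℂ) : ℝ≥0∞ :=
  ∫⁻ ξ, (‖F ξ‖₊ : ℝ≥0∞)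

/-- The norm `‖g‖_{FL^{-1,1}} = ‖⟨ξ⟩⁻¹ ĝ‖_{L¹}`, on the Fourier side. -/
def FLm1Norm (d : ℕ) (F : Edim d → ℂ) : ℝ≥0∞ :=
  ∫⁻ ξ, ENNReal.ofReal ((1 + ‖ξ‖ ^ 2) ^ (-(1 : ℝ) / 2) * ‖F ξ‖)

/-- Norm of `F⃗L¹ = FL^{0,1} × FL^{-1,1}`. -/
def pairFLNorm (d : ℕ) (F G : Edim d → ℂ) : ℝ≥0∞ :=
  FLNorm d F + FLm1Norm d G

/-- Membership in `F⃗L¹ = FL^{0,1} × FL^{-1,1}`, on the Fourier side. -/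
def MemFLPair (d : ℕ) (F G : Edim d → ℂ) : Prop :=
  Measurable F ∧ Measurable G ∧ pairFLNorm d F G < ⊤

/-- Symbol of `V₀(t)`: `cos((√3/2)|ξ|t) + (1/√3) sin((√3/2)|ξ|t)`. -/
def V0sym (t r : ℝ) : ℝ :=
  Real.cos (Real.sqrt 3 / 2 * r * t) + 1 / Real.sqrt 3 * Real.sin (Real.sqrt 3 / 2 * r * t)

/-- Symbol of `V₁(t)`: `sin((√3/2)|ξ|t) / ((√3/2)|ξ|)`. -/
def V1sym (t r : ℝ) : ℝ :=
  Real.sin (Real.sqrt 3 / 2 * r * t) / (Real.sqrt 3 / 2 * r)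

/-- Symbol of the Poisson kernel `P(t)`: `e^{-|ξ|t/2}`. -/
def Psym (t r : ℝ) : ℝ := Real.exp (-(r * t) / 2)

/-- Symbol of `W(t) = P(t)V₁(t)`. -/
def Wsym (t r : ℝ) : ℝ := Psym t r * V1sym t r

/-- Fourier side of the linear flow `V(t)(u₀,u₁) = P(t)(V₀(t)u₀ + V₁(t)u₁)`. -/
def Vflow (d : ℕ) (F₀ F₁ : Edim d → ℂ) (t : ℝ) (ξ : Edim d) : ℂ :=
  ((Psym t ‖ξ‖ * V0sym t ‖ξ‖ : ℝ) : ℂ) * F₀ ξ + ((Psym t ‖ξ‖ * V1sym t ‖ξ‖ : ℝ) : ℂ) * F₁ ξ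

/-- Convolution on `ℝ^d`. -/
def conv (d : ℕ) (f g : Edim d → ℂ) (ξ : Edim d) : ℂ :=
  ∫ η, f (ξ - η) * g η

/-- `convIter d f n` is the `(n+1)`-fold convolution `f ∗ ⋯ ∗ f`. -/
def convIter (d : ℕ) (f : Edim d → ℂ) : ℕ → Edim d → ℂ
  | 0 => f
  | n + 1 => conv d (convIter d f n) f

/-- Convolution of a (nonempty) list of functions. -/
def listConv (d : ℕ) : List (Edim d → ℂ) → Edim d → ℂ
  | [] => fun _ => 0
  | f :: fs => fs.foldl (conv d) f

/-- Fourier side of the Duhamel operator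
`I_k(u₁,…,u_k)(t) = -∫₀ᵗ W(t-t') ∏ u_j(t') dt'`. -/
def Ik (d k : ℕ) (us : Fin k → ℝ → Edim d → ℂ) (t : ℝ) (ξ : Edim d) : ℂ :=
  -(∫ t' in (0 : ℝ)..t,
      ((Wsym (t - t') ‖ξ‖ : ℝ) : ℂ) * listConv d (List.ofFn fun i => us i t') ξ)

/-- Picard iterates `Ξ_j` of vNLW, on the Fourier side:
`Ξ₀(u⃗₀)(t) = V(t)u⃗₀` and
`Ξ_j(u⃗₀) = ∑_{j₁+⋯+j_k = j-1} I_k(Ξ_{j₁}(u⃗₀),…,Ξ_{j_k}(u⃗₀))`. -/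
def Xi (d k : ℕ) (F₀ F₁ : Edim d → ℂ) : ℕ → ℝ → Edim d → ℂ
  | 0 => Vflow d F₀ F₁
  | j + 1 => fun t ξ =>
      ∑ l ∈ (Finset.Nat.antidiagonalTuple k j).attach,
        Ik d k (fun i => Xi d k F₀ F₁ (l.1 i)) t ξ
  decreasing_by
    have h := Finset.Nat.mem_antidiagonalTuple.mp l.2
    have hle := Finset.single_le_sum (f := l.1) (fun j _ => Nat.zero_le (l.1 j))
      (Finset.mem_univ i)
    omega

/-- `u : [0,T] → FL^{0,1}(ℝ^d)` (represented on the Fourier side) is a Duhamel solution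
of vNLW with nonlinearity `-u^k` and initial data `(u₀,u₁)` with `û₀ = F₀`, `û₁ = F₁`. -/
structure IsDuhamelSolution (d k : ℕ) (T : ℝ) (F₀ F₁ : Edim d → ℂ)
    (u : ℝ → Edim d → ℂ) : Prop where
  measurable : ∀ t ∈ Set.Icc (0 : ℝ) T, Measurable (u t)
  finite : ∀ t ∈ Set.Icc (0 : ℝ) T, FLNorm d (u t) < ⊤
  continuous : ∀ t₀ ∈ Set.Icc (0 : ℝ) T, ∀ ε : ℝ, 0 < ε → ∃ δ : ℝ, 0 < δ ∧
    ∀ t ∈ Set.Icc (0 : ℝ) T, |t - t₀| < δ →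
      FLNorm d (fun ξ => u t ξ - u t₀ ξ) < ENNReal.ofReal ε
  duhamel : ∀ t ∈ Set.Icc (0 : ℝ) T, ∀ᵐ ξ : Edim d, u t ξ =
    ((Psym t ‖ξ‖ * V0sym t ‖ξ‖ : ℝ) : ℂ) * F₀ ξ
      + ((Psym t ‖ξ‖ * V1sym t ‖ξ‖ : ℝ) : ℂ) * F₁ ξ
      - ∫ t' in (0 : ℝ)..t,
          ((Wsym (t - t') ‖ξ‖ : ℝ) : ℂ) * convIter d (u t') (k - 1) ξ

/-- The cube `Q_A = [-A/8, A/8]^d`. -/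
def cubeSet (d : ℕ) (A : ℝ) : Set (Edim d) := {ξ | ∀ i, |ξ i| ≤ A / 8}

/-- `Ω = ⋃_{η ∈ Σ} (η + Q_A)` with `Σ = {-2Ne₁, -Ne₁, Ne₁, 2Ne₁}`. -/
def OmegaSet (d : ℕ) (N A : ℝ) : Set (Edim d) :=
  {ξ | ∃ c : ℝ, (c = -2 * N ∨ c = -N ∨ c = N ∨ c = 2 * N) ∧
    ∀ i : Fin d, |ξ i - (if (i : ℕ) = 0 then c else 0)| ≤ A / 8}

/-- `Ω_k = ⋃_{η ∈ Σ_k} (η + Q_A)` with `Σ_k = {-Ne₁, Ne₁}` for even `k` and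
`Σ_k = {-2Ne₁, -Ne₁, Ne₁, 2Ne₁}` for odd `k`. -/
def OmegaKSet (d k : ℕ) (N A : ℝ) : Set (Edim d) :=
  {ξ | ∃ c : ℝ, (if k % 2 = 0 then c = -N ∨ c = N
      else c = -2 * N ∨ c = -N ∨ c = N ∨ c = 2 * N) ∧
    ∀ i : Fin d, |ξ i - (if (i : ℕ) = 0 then c else 0)| ≤ A / 8}

/-- `φ̂ = R·𝟙_Ω`. -/
def phiHat (d : ℕ) (N A R : ℝ) : Edim d → ℂ :=
  Set.indicator (OmegaSet d N A) fun _ => (R : ℂ)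

/-- `φ̂ = R·𝟙_{Ω_k}`. -/
def phiHatK (d k : ℕ) (N A R : ℝ) : Edim d → ℂ :=
  Set.indicator (OmegaKSet d k N A) fun _ => (R : ℂ)

/-- `g_s(A)`: `1` if `s < -d/2`; `(log⟨A⟩)^{1/2}` if `s = -d/2`; `A^{d/2+s}` if `s > -d/2`. -/
def gs (d : ℕ) (s A : ℝ) : ℝ :=
  if s < -(d : ℝ) / 2 then 1
  else if s = -(d : ℝ) / 2 then Real.sqrt (Real.log (Real.sqrt (1 + A ^ 2)))
  else A ^ ((d : ℝ) / 2 + s)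


section Minkowski

variable {Ω α : Type*} [MeasurableSpace Ω] [MeasurableSpace α]

lemma lintegral_mul_le_sqrt_mul_sqrt (μ : Measure α) {f g : α → ℝ≥0∞}
    (hf : AEMeasurable f μ) (hg : AEMeasurable g μ) :
    ∫⁻ x, f x * g x ∂μ ≤
      (∫⁻ x, f x ^ 2 ∂μ) ^ (1 / 2 : ℝ) * (∫⁻ x, g x ^ 2 ∂μ) ^ (1 / 2 : ℝ) := by
  simpa using ENNReal.lintegral_mul_le_Lp_mul_Lq μ Real.HolderConjugate.two_two hf hg

/-- Minkowski's integral inequality in `L²`. -/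
lemma lintegral_sq_lintegral_le {μ : Measure Ω} {ν : Measure α} [SFinite μ] [SFinite ν]
    {D : Ω → α → ℝ≥0∞} (hD : Measurable (Function.uncurry D)) :
    (∫⁻ x, (∫⁻ ω, D ω x ∂μ) ^ 2 ∂ν) ^ (1 / 2 : ℝ) ≤
      ∫⁻ ω, (∫⁻ x, D ω x ^ 2 ∂ν) ^ (1 / 2 : ℝ) ∂μ := by
  have hD1 : ∀ ω, Measurable (D ω) := fun ω => hD.comp measurable_prodMk_left
  have hD2 : ∀ x, Measurable fun ω => D ω x := fun x => hD.comp measurable_prodMk_right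
  have hB : Measurable fun ω => (∫⁻ x, D ω x ^ 2 ∂ν) ^ (1 / 2 : ℝ) := by
    have : Measurable fun ω => ∫⁻ x, D ω x ^ 2 ∂ν :=
      Measurable.lintegral_prod_right (f := fun ω x => D ω x ^ 2) (hD.pow_const 2)
    exact this.pow_const _
  have key : ∫⁻ x, (∫⁻ ω, D ω x ∂μ) ^ 2 ∂ν ≤
      (∫⁻ ω, (∫⁻ x, D ω x ^ 2 ∂ν) ^ (1 / 2 : ℝ) ∂μ) ^ 2 := by
    calc ∫⁻ x, (∫⁻ ω, D ω x ∂μ) ^ 2 ∂ν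
        = ∫⁻ x, ∫⁻ ω, ∫⁻ ω', D ω x * D ω' x ∂μ ∂μ ∂ν := by
          refine lintegral_congr fun x => ?_
          rw [sq, ← lintegral_mul_const _ (hD2 x)]
          exact lintegral_congr fun ω => (lintegral_const_mul _ (hD2 x)).symm
      _ = ∫⁻ ω, ∫⁻ x, ∫⁻ ω', D ω x * D ω' x ∂μ ∂ν ∂μ := by
          apply lintegral_lintegral_swap
          apply Measurable.aemeasurable
          apply Measurable.lintegral_prod_right
            (f := fun (p : α × Ω) ω' => D p.2 p.1 * D ω' p.1)
          exact (hD.comp (f := fun q : (α × Ω) × Ω => (q.1.2, q.1.1)) (by fun_prop)).mul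
            (hD.comp (f := fun q : (α × Ω) × Ω => (q.2, q.1.1)) (by fun_prop))
      _ = ∫⁻ ω, ∫⁻ ω', ∫⁻ x, D ω x * D ω' x ∂ν ∂μ ∂μ := by
          refine lintegral_congr fun ω => ?_
          apply lintegral_lintegral_swap
          exact (((hD1 ω).comp measurable_fst).mul
            (hD.comp (f := fun q : α × Ω => (q.2, q.1)) (by fun_prop))).aemeasurable
      _ ≤ ∫⁻ ω, ∫⁻ ω', (∫⁻ x, D ω x ^ 2 ∂ν) ^ (1 / 2 : ℝ) *
            (∫⁻ x, D ω' x ^ 2 ∂ν) ^ (1 / 2 : ℝ) ∂μ ∂μ :=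
          lintegral_mono fun ω => lintegral_mono fun ω' =>
            lintegral_mul_le_sqrt_mul_sqrt ν (hD1 ω).aemeasurable (hD1 ω').aemeasurable
      _ = _ := by
          rw [sq, ← lintegral_mul_const _ hB]
          exact lintegral_congr fun ω => lintegral_const_mul _ hB
  calc _ ≤ ((∫⁻ ω, (∫⁻ x, D ω x ^ 2 ∂ν) ^ (1 / 2 : ℝ) ∂μ) ^ 2) ^ (1 / 2 : ℝ) := by gcongr
    _ = _ := by
      rw [← ENNReal.rpow_two, ← ENNReal.rpow_mul]; norm_num

end Minkowski

lemma eLpNorm_two_eq {α : Type*} [MeasurableSpace α] (μ : Measure α) (f : α → ℂ) :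
    eLpNorm f 2 μ = (∫⁻ x, ‖f x‖ₑ ^ 2 ∂μ) ^ (1 / 2 : ℝ) := by
  rw [eLpNorm_eq_lintegral_rpow_enorm_toReal (by norm_num) (by norm_num)]
  simp

section Convolution

variable {d : ℕ}

lemma conv_comm (f g : Edim d → ℂ) : conv d f g = conv d g f := by
  funext ξ
  unfold conv
  rw [← integral_sub_left_eq_self _ volume ξ]
  simp [mul_comm]

lemma eLpNorm_one_conv_le {f g : Edim d → ℂ} (hf : Measurable f) (hg : Measurable g) :
    eLpNorm (conv d f g) 1 ≤ eLpNorm f 1 * eLpNorm g 1 := by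
  simp only [eLpNorm_one_eq_lintegral_enorm]
  calc ∫⁻ ξ, ‖conv d f g ξ‖ₑ ≤ ∫⁻ ξ, ∫⁻ η, ‖f (ξ - η)‖ₑ * ‖g η‖ₑ :=
        lintegral_mono fun ξ => (enorm_integral_le_lintegral_enorm _).trans_eq
          (by simp [enorm_mul])
    _ = ∫⁻ η, ∫⁻ ξ, ‖f (ξ - η)‖ₑ * ‖g η‖ₑ :=
        lintegral_lintegral_swap (by fun_prop)
    _ = ∫⁻ η, (∫⁻ ξ, ‖f ξ‖ₑ) * ‖g η‖ₑ := by
        refine lintegral_congr fun η => ?_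
        rw [lintegral_mul_const _ (by fun_prop),
          lintegral_sub_right_eq_self (fun ξ => ‖f ξ‖ₑ) η]
    _ = _ := lintegral_const_mul _ (by fun_prop)

/-- Young's inequality `L² ∗ L¹ ⊆ L²`. -/
lemma eLpNorm_two_conv_le {f g : Edim d → ℂ} (hf : Measurable f) (hg : Measurable g) :
    eLpNorm (conv d f g) 2 ≤ eLpNorm f 2 * eLpNorm g 1 := by
  rw [eLpNorm_one_eq_lintegral_enorm, eLpNorm_two_eq, eLpNorm_two_eq]
  calc (∫⁻ ξ, ‖conv d f g ξ‖ₑ ^ 2) ^ (1 / 2 : ℝ)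
      ≤ (∫⁻ ξ, (∫⁻ η, ‖f (ξ - η)‖ₑ * ‖g η‖ₑ) ^ 2) ^ (1 / 2 : ℝ) := by
        gcongr with ξ
        exact (enorm_integral_le_lintegral_enorm _).trans_eq (by simp [enorm_mul])
    _ ≤ ∫⁻ η, (∫⁻ ξ, (‖f (ξ - η)‖ₑ * ‖g η‖ₑ) ^ 2) ^ (1 / 2 : ℝ) :=
        lintegral_sq_lintegral_le (D := fun η ξ => ‖f (ξ - η)‖ₑ * ‖g η‖ₑ)
          (by unfold Function.uncurry; fun_prop)
    _ = ∫⁻ η, (∫⁻ ξ, ‖f ξ‖ₑ ^ 2) ^ (1 / 2 : ℝ) * ‖g η‖ₑ := by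
        refine lintegral_congr fun η => ?_
        simp only [mul_pow]
        rw [lintegral_mul_const _ (by fun_prop),
          lintegral_sub_right_eq_self (fun ξ => ‖f ξ‖ₑ ^ 2) η,
          ENNReal.mul_rpow_of_nonneg _ _ (by norm_num), ← ENNReal.rpow_two,
          ← ENNReal.rpow_mul]
        norm_num
    _ = _ := lintegral_const_mul _ (by fun_prop)

lemma measurable_conv_uncurry {Ω : Type*} [MeasurableSpace Ω] {F G : Ω → Edim d → ℂ}
    (hF : Measurable (Function.uncurry F)) (hG : Measurable (Function.uncurry G)) :
    Measurable (Function.uncurry fun ω => conv d (F ω) (G ω)) := by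
  have h : Measurable (Function.uncurry fun (p : Ω × Edim d) η =>
      F p.1 (p.2 - η) * G p.1 η) :=
    (hF.comp (f := fun q : (Ω × Edim d) × Edim d => (q.1.1, q.1.2 - q.2)) (by fun_prop)).mul
      (hG.comp (f := fun q : (Ω × Edim d) × Edim d => (q.1.1, q.2)) (by fun_prop))
  exact (StronglyMeasurable.integral_prod_right h.stronglyMeasurable).measurable

lemma measurable_conv {f g : Edim d → ℂ} (hf : Measurable f) (hg : Measurable g) :
    Measurable (conv d f g) :=
  (measurable_conv_uncurry (Ω := Unit) (F := fun _ => f) (G := fun _ => g)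
    (hf.comp measurable_snd) (hg.comp measurable_snd)).of_uncurry_left (x := ())

lemma measurable_convIter_uncurry {Ω : Type*} [MeasurableSpace Ω] {F : Ω → Edim d → ℂ}
    (hF : Measurable (Function.uncurry F)) (n : ℕ) :
    Measurable (Function.uncurry fun ω => convIter d (F ω) n) := by
  induction n with
  | zero => exact hF
  | succ n ih => exact measurable_conv_uncurry ih hF

lemma measurable_convIter {f : Edim d → ℂ} (hf : Measurable f) (n : ℕ) :
    Measurable (convIter d f n) := by
  induction n with
  | zero => exact hf
  | succ n ih => exact measurable_conv ih hf

lemma eLpNorm_one_convIter_le {f : Edim d → ℂ} (hf : Measurable f) (n : ℕ) :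
    eLpNorm (convIter d f n) 1 ≤ eLpNorm f 1 ^ (n + 1) := by
  induction n with
  | zero => simp [convIter]
  | succ n ih =>
    calc _ ≤ _ := eLpNorm_one_conv_le (measurable_convIter hf n) hf
      _ ≤ eLpNorm f 1 ^ (n + 1) * eLpNorm f 1 := by gcongr
      _ = _ := by rw [pow_succ _ (n + 1)]

lemma norm_convIter_le {f : Edim d → ℂ} {b : Edim d → ℝ} {M : ℝ} (hM : 0 ≤ M)
    (hb : Integrable b) (hfb : ∀ ξ, ‖f ξ‖ ≤ b ξ) (hbM : ∀ ξ, b ξ ≤ M) (n : ℕ) (ξ : Edim d) :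
    ‖convIter d f n ξ‖ ≤ M * (∫ η, b η) ^ n := by
  induction n generalizing ξ with
  | zero => simpa [convIter] using (hfb ξ).trans (hbM ξ)
  | succ n ih =>
    have hb0 : 0 ≤ ∫ η, b η := integral_nonneg fun η => (norm_nonneg _).trans (hfb η)
    calc ‖convIter d f (n + 1) ξ‖ ≤ ∫ η, M * (∫ η, b η) ^ n * b η := by
          refine norm_integral_le_of_norm_le (hb.const_mul _) (.of_forall fun η => ?_)
          rw [norm_mul]
          gcongr
          exacts [ih _, hfb η]
      _ = _ := by rw [integral_const_mul]; ring

lemma convIter_add_sub {f g : Edim d → ℂ} (hf : Measurable f) (hg : Measurable g)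
    {b c : Edim d → ℝ} {M : ℝ} (hM : 0 ≤ M) (hb : Integrable b) (hc : Integrable c)
    (hfb : ∀ ξ, ‖f ξ‖ ≤ b ξ) (hgc : ∀ ξ, ‖g ξ‖ ≤ c ξ) (hbc : ∀ ξ, b ξ + c ξ ≤ M) (n : ℕ) :
    (fun ξ => convIter d (fun η => f η + g η) (n + 1) ξ - convIter d g (n + 1) ξ) =
      (conv d (fun ξ => convIter d (fun η => f η + g η) n ξ - convIter d g n ξ)
        (fun η => f η + g η)) + conv d (convIter d g n) f := by
  have hfi : Integrable f := hb.mono' hf.aestronglyMeasurable (.of_forall hfb)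
  have hgi : Integrable g := hc.mono' hg.aestronglyMeasurable (.of_forall hgc)
  have hcM : ∀ ξ, c ξ ≤ M := fun ξ => by linarith [hbc ξ, (norm_nonneg _).trans (hfb ξ)]
  have hH := norm_convIter_le (f := fun η => f η + g η) (b := fun η => b η + c η) hM (hb.add hc)
    (fun ξ => (norm_add_le _ _).trans (add_le_add (hfb ξ) (hgc ξ))) hbc n
  have hG := norm_convIter_le hM hc hgc hcM n
  have hHm := measurable_convIter (hf.add hg) n
  have hGm := measurable_convIter hg n
  funext ξ
  have i1 : Integrable fun η => convIter d (fun η => f η + g η) n (ξ - η) * (f η + g η) :=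
    (hfi.add hgi).bdd_mul (by exact (hHm.comp (by fun_prop)).aestronglyMeasurable)
      (.of_forall fun η => hH _)
  have i2 : Integrable fun η => convIter d g n (ξ - η) * g η :=
    hgi.bdd_mul (hGm.comp (by fun_prop)).aestronglyMeasurable (.of_forall fun η => hG _)
  have i3 : Integrable fun η => convIter d g n (ξ - η) * f η :=
    hfi.bdd_mul (hGm.comp (by fun_prop)).aestronglyMeasurable (.of_forall fun η => hG _)
  simp only [Pi.add_apply, convIter, conv] at i1 i2 i3 ⊢
  simp only [sub_mul]
  have i4 : Integrable fun η => convIter d g n (ξ - η) * (f η + g η) := by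
    simp only [mul_add]; exact i3.add i2
  rw [integral_sub i1 i4]
  have : ∫ η, convIter d g n (ξ - η) * (f η + g η) =
      (∫ η, convIter d g n (ξ - η) * f η) + ∫ η, convIter d g n (ξ - η) * g η := by
    simp only [mul_add]; exact integral_add i3 i2
  rw [this]; ring

/-- `‖(f+g)^{∗(n+1)} - g^{∗(n+1)}‖_{L²}` is controlled by the lower powers of `‖g‖_{L¹}`. -/
lemma eLpNorm_convIter_add_sub_le {f g : Edim d → ℂ} (hf : Measurable f) (hg : Measurable g)
    {b c : Edim d → ℝ} {M : ℝ} (hM : 0 ≤ M) (hb : Integrable b) (hc : Integrable c)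
    (hfb : ∀ ξ, ‖f ξ‖ ≤ b ξ) (hgc : ∀ ξ, ‖g ξ‖ ≤ c ξ) (hbc : ∀ ξ, b ξ + c ξ ≤ M)
    {B a : ℝ≥0∞} (hf1 : eLpNorm f 1 ≤ B) (hf2 : eLpNorm f 2 ≤ B) (hg1 : eLpNorm g 1 ≤ a)
    (n : ℕ) :
    eLpNorm (fun ξ => convIter d (fun η => f η + g η) n ξ - convIter d g n ξ) 2 ≤
      (B + 2) ^ (n + 1) * ∑ m ∈ Finset.range (n + 1), a ^ m := by
  induction n with
  | zero =>
    simp only [convIter, add_sub_cancel_right, zero_add, pow_one, Finset.range_one,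
      Finset.sum_singleton, pow_zero, mul_one]
    exact hf2.trans le_self_add
  | succ n ih =>
    have hfg : Measurable fun η => f η + g η := hf.add hg
    have hDm := (measurable_convIter hfg n).sub (measurable_convIter hg n)
    set S := fun n => ∑ m ∈ Finset.range (n + 1), a ^ m with hS
    have hS1 : S n ≤ S (n + 1) := by
      simp only [hS]; rw [Finset.sum_range_succ _ (n + 1)]; exact le_self_add
    have hS2 : S n * a ≤ S (n + 1) := by
      simp only [hS]
      rw [Finset.sum_range_succ' _ (n + 1), Finset.sum_mul]
      simp only [pow_succ]; exact le_self_add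
    have hS3 : a ^ (n + 1) ≤ S (n + 1) := by
      simp only [hS]; rw [Finset.sum_range_succ _ (n + 1)]; exact le_add_self
    have hB1 : (1 : ℝ≥0∞) ≤ (B + 2) ^ (n + 1) := one_le_pow₀ (by
      calc (1 : ℝ≥0∞) ≤ 2 := by norm_num
        _ ≤ _ := le_add_self)
    have hh1 : eLpNorm (fun η => f η + g η) 1 ≤ B + a :=
      (eLpNorm_add_le hf.aestronglyMeasurable hg.aestronglyMeasurable le_rfl).trans
        (add_le_add hf1 hg1)
    rw [convIter_add_sub hf hg hM hb hc hfb hgc hbc n]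
    calc _ ≤ _ := eLpNorm_add_le (measurable_conv hDm hfg).aestronglyMeasurable
          (measurable_conv (measurable_convIter hg n) hf).aestronglyMeasurable (by norm_num)
      _ ≤ (B + 2) ^ (n + 1) * S n * (B + a) + B * a ^ (n + 1) := by
        refine add_le_add ?_ ?_
        · refine (eLpNorm_two_conv_le hDm hfg).trans ?_
          gcongr
          exact ih
        · rw [conv_comm]
          refine (eLpNorm_two_conv_le hf (measurable_convIter hg n)).trans ?_
          gcongr
          exact (eLpNorm_one_convIter_le hg n).trans (by gcongr)
      _ = (B + 2) ^ (n + 1) * (B * S n + S n * a) + B * a ^ (n + 1) := by ring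
      _ ≤ (B + 2) ^ (n + 1) * (B * S (n + 1) + S (n + 1)) +
            (B + 2) ^ (n + 1) * S (n + 1) := by
        refine add_le_add (by gcongr) (mul_le_mul' ?_ hS3)
        calc B ≤ B + 2 := le_self_add
          _ ≤ _ := le_self_pow₀ (le_trans (by norm_num) (le_add_self : (2 : ℝ≥0∞) ≤ B + 2)) (by omega)
      _ = _ := by ring

end Convolution

section Symbols

lemma abs_V0sym_le (t r : ℝ) : |V0sym t r| ≤ 2 := by
  have h3 : 1 ≤ √3 := by rw [Real.one_le_sqrt]; norm_num
  have h : |1 / √3| ≤ 1 := by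
    rw [abs_of_nonneg (by positivity)]
    exact (div_le_one (by positivity)).2 h3
  unfold V0sym
  calc _ ≤ |cos (√3 / 2 * r * t)| + |1 / √3 * sin (√3 / 2 * r * t)| := abs_add_le _ _
    _ ≤ 1 + 1 * 1 := by
      rw [abs_mul]
      gcongr
      exacts [abs_cos_le_one _, abs_sin_le_one _]
    _ = 2 := by norm_num

lemma abs_V1sym_le {t r : ℝ} (ht : 0 ≤ t) (hr : 0 ≤ r) : |V1sym t r| ≤ t := by
  unfold V1sym
  rw [abs_div, abs_of_nonneg (by positivity : 0 ≤ √3 / 2 * r)]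
  refine div_le_of_le_mul₀ (by positivity) ht ?_
  calc |sin (√3 / 2 * r * t)| ≤ |√3 / 2 * r * t| := abs_sin_le_abs
    _ = t * (√3 / 2 * r) := by rw [abs_of_nonneg (by positivity)]; ring

lemma V1sym_mul_sq_le (t r : ℝ) : (V1sym t r * r) ^ 2 ≤ 4 / 3 := by
  rcases eq_or_ne r 0 with rfl | hr
  · norm_num
  have h : V1sym t r * r = 2 / √3 * sin (√3 / 2 * r * t) := by
    unfold V1sym; field_simp
  rw [h, mul_pow, div_pow, Real.sq_sqrt (by norm_num)]
  nlinarith [sin_sq_le_one (√3 / 2 * r * t)]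

lemma abs_V1sym_le_bracket {t r : ℝ} (ht : 0 ≤ t) (ht1 : t ≤ 1) (hr : 0 ≤ r) :
    |V1sym t r| ≤ 2 * (1 + r ^ 2) ^ (-(1 : ℝ) / 2) := by
  have hpos : 0 < 1 + r ^ 2 := by positivity
  have h1 : |V1sym t r| ≤ 1 := (abs_V1sym_le ht hr).trans ht1
  have h2 : V1sym t r ^ 2 ≤ 1 := (sq_le_one_iff_abs_le_one _).2 h1
  have h3 := V1sym_mul_sq_le t r
  have h4 : ((1 + r ^ 2) ^ (-(1 : ℝ) / 2)) ^ 2 = (1 + r ^ 2)⁻¹ := by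
    rw [← Real.rpow_natCast, ← Real.rpow_mul hpos.le, ← Real.rpow_neg_one]; norm_num
  refine abs_le_of_sq_le_sq ?_ (by positivity)
  rw [mul_pow, h4, ← div_eq_mul_inv, le_div_iff₀ hpos]
  nlinarith

lemma Psym_nonneg (t r : ℝ) : 0 ≤ Psym t r := (Real.exp_pos _).le

lemma Psym_le_one {t r : ℝ} (ht : 0 ≤ t) (hr : 0 ≤ r) : Psym t r ≤ 1 :=
  Real.exp_le_one_iff.2 (by nlinarith [mul_nonneg hr ht])

lemma abs_Wsym_le {t r : ℝ} (ht : 0 ≤ t) (hr : 0 ≤ r) : |Wsym t r| ≤ t := by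
  unfold Wsym
  rw [abs_mul, abs_of_nonneg (Psym_nonneg _ _)]
  calc _ ≤ 1 * t := by
        gcongr
        exacts [Psym_le_one ht hr, abs_V1sym_le ht hr]
    _ = t := one_mul t

end Symbols

section Flow

variable {d : ℕ}

lemma measurable_Vflow {F₀ F₁ : Edim d → ℂ} (h₀ : Measurable F₀) (h₁ : Measurable F₁) :
    Measurable (Function.uncurry (Vflow d F₀ F₁)) := by
  unfold Function.uncurry Vflow Psym V0sym V1sym
  fun_prop

lemma Vflow_add (F₀ F₁ G : Edim d → ℂ) (t : ℝ) :
    Vflow d (fun ξ => F₀ ξ + G ξ) F₁ t =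
      fun ξ => Vflow d F₀ F₁ t ξ + Vflow d G (fun _ => 0) t ξ := by
  funext ξ
  unfold Vflow
  ring

lemma norm_Vflow_le (F₀ F₁ : Edim d → ℂ) {t : ℝ} (ht : 0 ≤ t) (ht1 : t ≤ 1) (ξ : Edim d) :
    ‖Vflow d F₀ F₁ t ξ‖ ≤
      2 * (‖F₀ ξ‖ + (1 + ‖ξ‖ ^ 2) ^ (-(1 : ℝ) / 2) * ‖F₁ ξ‖) := by
  have hP := Psym_le_one ht (norm_nonneg ξ)
  have hP0 := Psym_nonneg t ‖ξ‖
  have h0 : ‖((Psym t ‖ξ‖ * V0sym t ‖ξ‖ : ℝ) : ℂ)‖ ≤ 1 * 2 := by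
    rw [Complex.norm_real, Real.norm_eq_abs, abs_mul, abs_of_nonneg hP0]
    gcongr
    exact abs_V0sym_le _ _
  have h1 : ‖((Psym t ‖ξ‖ * V1sym t ‖ξ‖ : ℝ) : ℂ)‖ ≤
      1 * (2 * (1 + ‖ξ‖ ^ 2) ^ (-(1 : ℝ) / 2)) := by
    rw [Complex.norm_real, Real.norm_eq_abs, abs_mul, abs_of_nonneg hP0]
    gcongr
    exact abs_V1sym_le_bracket ht ht1 (norm_nonneg ξ)
  unfold Vflow
  calc _ ≤ _ := norm_add_le _ _
    _ ≤ 1 * 2 * ‖F₀ ξ‖ + 1 * (2 * (1 + ‖ξ‖ ^ 2) ^ (-(1 : ℝ) / 2)) * ‖F₁ ξ‖ := by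
      rw [norm_mul, norm_mul]; gcongr
    _ = _ := by ring

lemma eLpNorm_one_Vflow_le {F₀ F₁ : Edim d → ℂ} (h₀ : Measurable F₀)
    (h : pairFLNorm d F₀ F₁ ≤ 1) {t : ℝ} (ht : 0 ≤ t) (ht1 : t ≤ 1) :
    eLpNorm (Vflow d F₀ F₁ t) 1 ≤ 2 := by
  rw [eLpNorm_one_eq_lintegral_enorm]
  calc ∫⁻ ξ, ‖Vflow d F₀ F₁ t ξ‖ₑ
      ≤ ∫⁻ ξ, 2 * ((‖F₀ ξ‖₊ : ℝ≥0∞) +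
          ENNReal.ofReal ((1 + ‖ξ‖ ^ 2) ^ (-(1 : ℝ) / 2) * ‖F₁ ξ‖)) := by
        refine lintegral_mono fun ξ => ?_
        rw [← ofReal_norm]
        refine (ENNReal.ofReal_le_ofReal (norm_Vflow_le F₀ F₁ ht ht1 ξ)).trans_eq ?_
        rw [ENNReal.ofReal_mul (by norm_num), ENNReal.ofReal_add (by positivity) (by positivity),
          ofReal_norm, ENNReal.ofReal_ofNat]
        rfl
    _ = 2 * pairFLNorm d F₀ F₁ := by
        rw [lintegral_const_mul' _ _ (by norm_num), lintegral_add_left (by fun_prop)]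
        rfl
    _ ≤ 2 * 1 := by gcongr
    _ = 2 := mul_one 2

lemma eLpNorm_two_Vflow_le {F₀ F₁ : Edim d → ℂ} (h₀ : Measurable F₀)
    (h : pairHsNorm d 0 F₀ F₁ ≤ 1) {t : ℝ} (ht : 0 ≤ t) (ht1 : t ≤ 1) :
    eLpNorm (Vflow d F₀ F₁ t) 2 ≤ 4 := by
  have h' : HsNormSq d 0 F₀ + HsNormSq d (0 - 1) F₁ ≤ 1 := by
    unfold pairHsNorm at h
    rwa [← ENNReal.one_rpow (1 / 2 : ℝ), ENNReal.rpow_le_rpow_iff (by norm_num)] at h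
  rw [eLpNorm_two_eq]
  calc (∫⁻ ξ, ‖Vflow d F₀ F₁ t ξ‖ₑ ^ 2) ^ (1 / 2 : ℝ)
      ≤ (∫⁻ ξ, 8 * (ENNReal.ofReal ((1 + ‖ξ‖ ^ 2) ^ (0 : ℝ) * ‖F₀ ξ‖ ^ 2) +
          ENNReal.ofReal ((1 + ‖ξ‖ ^ 2) ^ (0 - 1 : ℝ) * ‖F₁ ξ‖ ^ 2))) ^ (1 / 2 : ℝ) := by
        gcongr with ξ
        have hpos : 0 < 1 + ‖ξ‖ ^ 2 := by positivity
        have hw : ((1 + ‖ξ‖ ^ 2) ^ (-(1 : ℝ) / 2)) ^ 2 = (1 + ‖ξ‖ ^ 2) ^ (0 - 1 : ℝ) := by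
          rw [← Real.rpow_natCast, ← Real.rpow_mul hpos.le]; norm_num
        rw [← ofReal_norm, ← ENNReal.ofReal_pow (norm_nonneg _),
          ← ENNReal.ofReal_add (by positivity) (by positivity), ← ENNReal.ofReal_ofNat,
          ← ENNReal.ofReal_mul (by norm_num)]
        refine ENNReal.ofReal_le_ofReal ?_
        have hV := norm_Vflow_le F₀ F₁ ht ht1 ξ
        rw [Real.rpow_zero, one_mul, ← hw]
        set w := (1 + ‖ξ‖ ^ 2) ^ (-(1 : ℝ) / 2)
        calc ‖Vflow d F₀ F₁ t ξ‖ ^ 2 ≤ (2 * (‖F₀ ξ‖ + w * ‖F₁ ξ‖)) ^ 2 := by gcongr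
          _ ≤ _ := by nlinarith [sq_nonneg (‖F₀ ξ‖ - w * ‖F₁ ξ‖)]
    _ = (8 * (HsNormSq d 0 F₀ + HsNormSq d (0 - 1) F₁)) ^ (1 / 2 : ℝ) := by
        rw [lintegral_const_mul' _ _ (by norm_num), lintegral_add_left (by fun_prop)]
        rfl
    _ ≤ (4 ^ (2 : ℝ)) ^ (1 / 2 : ℝ) := by
        gcongr
        calc _ ≤ (8 : ℝ≥0∞) * 1 := by gcongr
          _ ≤ _ := by norm_num
    _ = 4 := by rw [← ENNReal.rpow_mul]; norm_num

lemma measurableSet_box (v : Fin d → ℝ) (r : ℝ) :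
    MeasurableSet {ξ : Edim d | ∀ i, |ξ i - v i| ≤ r} := by
  simp only [Set.ofPred_forall]
  exact .iInter fun i => measurableSet_le (by fun_prop) (by fun_prop)

lemma volume_box (v : Fin d → ℝ) (r : ℝ) :
    volume {ξ : Edim d | ∀ i, |ξ i - v i| ≤ r} = ENNReal.ofReal (2 * r) ^ d := by
  have hs : {ξ : Edim d | ∀ i, |ξ i - v i| ≤ r} =
      WithLp.ofLp ⁻¹' Icc (fun i => v i - r) (fun i => v i + r) := by
    ext ξ
    simp only [mem_ofPred_eq, mem_preimage, mem_Icc, Pi.le_def, abs_sub_le_iff, ← forall_and]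
    refine forall_congr' fun i => ?_
    constructor <;> rintro ⟨h1, h2⟩ <;> constructor <;> linarith
  rw [hs, (PiLp.volume_preserving_ofLp (Fin d)).measure_preimage
      measurableSet_Icc.nullMeasurableSet,
    Real.volume_Icc_pi]
  simp only [add_sub_sub_cancel, Finset.prod_const, Finset.card_univ, Fintype.card_fin, two_mul]

lemma OmegaKSet_subset (k : ℕ) (N A : ℝ) : OmegaKSet d k N A ⊆ OmegaSet d N A := by
  rintro ξ ⟨c, hc, h⟩
  refine ⟨c, ?_, h⟩
  split_ifs at hc <;> tauto

lemma measurableSet_OmegaKSet (k : ℕ) (N A : ℝ) : MeasurableSet (OmegaKSet d k N A) := by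
  have : OmegaKSet d k N A = ⋃ c ∈ {c : ℝ | if k % 2 = 0 then c = -N ∨ c = N
      else c = -2 * N ∨ c = -N ∨ c = N ∨ c = 2 * N},
      {ξ : Edim d | ∀ i, |ξ i - (if (i : ℕ) = 0 then c else 0)| ≤ A / 8} := by
    ext ξ; simp [OmegaKSet]
  rw [this]
  refine MeasurableSet.biUnion (Set.Finite.countable ?_) fun c _ => measurableSet_box _ _
  refine Set.Finite.subset (Set.toFinite {-2 * N, -N, N, 2 * N}) fun c hc => ?_
  simp only [mem_ofPred_eq] at hc
  simp only [Set.mem_insert_iff, Set.mem_singleton_iff]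
  split_ifs at hc <;> tauto

lemma volume_OmegaKSet_le (k : ℕ) (N : ℝ) {A : ℝ} (hA : 0 ≤ A) :
    volume (OmegaKSet d k N A) ≤ ENNReal.ofReal (4 * A ^ d) := by
  set box := fun c : ℝ => {ξ : Edim d | ∀ i, |ξ i - (if (i : ℕ) = 0 then c else 0)| ≤ A / 8}
  have hbox : ∀ c, volume (box c) ≤ ENNReal.ofReal (A ^ d) := fun c => by
    simp only [box]
    rw [volume_box, ENNReal.ofReal_pow hA]
    gcongr
    linarith
  have hsub : OmegaKSet d k N A ⊆ (box (-2 * N) ∪ box (-N)) ∪ (box N ∪ box (2 * N)) := by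
    refine (OmegaKSet_subset k N A).trans ?_
    rintro ξ ⟨c, hc | hc | hc | hc, h⟩ <;> subst hc
    exacts [.inl (.inl h), .inl (.inr h), .inr (.inl h), .inr (.inr h)]
  calc _ ≤ _ := measure_mono hsub
    _ ≤ (volume (box (-2 * N)) + volume (box (-N))) + (volume (box N) + volume (box (2 * N))) :=
      (measure_union_le _ _).trans (add_le_add (measure_union_le _ _) (measure_union_le _ _))
    _ ≤ (ENNReal.ofReal (A ^ d) + ENNReal.ofReal (A ^ d)) +
          (ENNReal.ofReal (A ^ d) + ENNReal.ofReal (A ^ d)) := by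
      gcongr <;> exact hbox _
    _ = _ := by
      rw [ENNReal.ofReal_mul (by norm_num), ENNReal.ofReal_ofNat]; ring

lemma half_le_norm_of_mem_OmegaKSet (hd : 1 ≤ d) {k : ℕ} {N A : ℝ} (hA : 0 ≤ A) (hAN : A ≤ N)
    {ξ : Edim d} (hξ : ξ ∈ OmegaKSet d k N A) : N / 2 ≤ ‖ξ‖ := by
  obtain ⟨c, hc, h⟩ := OmegaKSet_subset k N A hξ
  have h0 := h ⟨0, hd⟩
  simp only [if_true] at h0
  have hN : 0 ≤ N := hA.trans hAN
  have hn : |ξ ⟨0, hd⟩| ≤ ‖ξ‖ := PiLp.norm_apply_le ξ ⟨0, hd⟩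
  rw [abs_le] at h0 hn
  rcases hc with rfl | rfl | rfl | rfl <;> linarith

lemma measurable_phiHatK (k : ℕ) (N A R : ℝ) : Measurable (phiHatK d k N A R) :=
  measurable_const.indicator (measurableSet_OmegaKSet k N A)

lemma norm_Vflow_phiHatK_le (hd : 1 ≤ d) (k : ℕ) {N A R : ℝ} (hA : 0 ≤ A) (hAN : A ≤ N)
    (hR : 0 ≤ R) {t : ℝ} (ht : 0 ≤ t) (ξ : Edim d) :
    ‖Vflow d (phiHatK d k N A R) (fun _ => 0) t ξ‖ ≤
      (OmegaKSet d k N A).indicator (fun _ => 2 * R * exp (-(N / 4) * t)) ξ := by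
  unfold Vflow phiHatK
  by_cases hξ : ξ ∈ OmegaKSet d k N A
  · rw [indicator_of_mem hξ, indicator_of_mem hξ, mul_zero, add_zero, norm_mul,
      Complex.norm_real, Complex.norm_real, Real.norm_eq_abs, Real.norm_eq_abs, abs_mul,
      abs_of_nonneg (Psym_nonneg _ _), abs_of_nonneg hR]
    have hP : Psym t ‖ξ‖ ≤ exp (-(N / 4) * t) := by
      refine Real.exp_le_exp.2 ?_
      nlinarith [mul_le_mul_of_nonneg_right (half_le_norm_of_mem_OmegaKSet hd hA hAN hξ) ht]
    calc _ ≤ exp (-(N / 4) * t) * 2 * R := by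
          gcongr
          exact abs_V0sym_le _ _
      _ = _ := by ring
  · simp [indicator_of_notMem hξ]

lemma eLpNorm_one_Vflow_phiHatK_le (hd : 1 ≤ d) (k : ℕ) {N A R : ℝ} (hA : 0 ≤ A) (hAN : A ≤ N)
    (hR : 0 ≤ R) {t : ℝ} (ht : 0 ≤ t) :
    eLpNorm (Vflow d (phiHatK d k N A R) (fun _ => 0) t) 1 ≤
      ENNReal.ofReal (8 * (R * A ^ d) * exp (-(N / 4) * t)) := by
  calc _ ≤ eLpNorm ((OmegaKSet d k N A).indicator
          (fun _ => 2 * R * exp (-(N / 4) * t))) 1 := by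
        exact eLpNorm_mono_real fun ξ => norm_Vflow_phiHatK_le hd k hA hAN hR ht ξ
    _ = ENNReal.ofReal (2 * R * exp (-(N / 4) * t)) * volume (OmegaKSet d k N A) := by
        rw [eLpNorm_indicator_const (measurableSet_OmegaKSet k N A) one_ne_zero (by simp),
          Real.enorm_of_nonneg (by positivity)]
        simp
    _ ≤ ENNReal.ofReal (2 * R * exp (-(N / 4) * t)) * ENNReal.ofReal (4 * A ^ d) := by
        gcongr
        exact volume_OmegaKSet_le k N hA
    _ = _ := by
        rw [← ENNReal.ofReal_mul (by positivity)]; congr 1; ring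

end Flow

section Duhamel

variable {d : ℕ}

lemma foldl_conv_replicate (f h : Edim d → ℂ) (n : ℕ) :
    (List.replicate n f).foldl (conv d) h = (fun g => conv d g f)^[n] h := by
  induction n generalizing h with
  | zero => rfl
  | succ n ih => rw [List.replicate_succ, List.foldl_cons, ih, Function.iterate_succ_apply]

lemma convIter_eq_iterate (f : Edim d → ℂ) (n : ℕ) :
    convIter d f n = (fun g => conv d g f)^[n] f := by
  induction n with
  | zero => rfl
  | succ n ih => rw [Function.iterate_succ_apply', ← ih]; rfl

lemma listConv_replicate (f : Edim d → ℂ) (n : ℕ) :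
    listConv d (List.replicate (n + 1) f) = convIter d f n := by
  rw [convIter_eq_iterate, ← foldl_conv_replicate]
  rfl

lemma Xi_one {k : ℕ} (hk : 1 ≤ k) (F₀ F₁ : Edim d → ℂ) (t : ℝ) (ξ : Edim d) :
    Xi d k F₀ F₁ 1 t ξ = -∫ t' in (0 : ℝ)..t,
      ((Wsym (t - t') ‖ξ‖ : ℝ) : ℂ) * convIter d (Vflow d F₀ F₁ t') (k - 1) ξ := by
  obtain ⟨n, rfl⟩ : ∃ n, k = n + 1 := ⟨k - 1, by omega⟩
  rw [Xi]
  beta_reduce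
  rw [Finset.sum_attach (Finset.Nat.antidiagonalTuple (n + 1) 0)
    (fun l => Ik d (n + 1) (fun i => Xi d (n + 1) F₀ F₁ (l i)) t ξ),
    Finset.Nat.antidiagonalTuple_zero_right, Finset.sum_singleton]
  simp only [Ik, Pi.zero_apply, Xi, List.ofFn_const, listConv_replicate, Nat.add_sub_cancel]

lemma HsNorm_le_eLpNorm {s : ℝ} (hs : s ≤ 0) (F : Edim d → ℂ) : HsNorm d s F ≤ eLpNorm F 2 := by
  rw [eLpNorm_two_eq]
  unfold HsNorm HsNormSq
  gcongr with ξ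
  rw [← ofReal_norm, ← ENNReal.ofReal_pow (norm_nonneg _)]
  refine ENNReal.ofReal_le_ofReal (mul_le_of_le_one_left (by positivity) ?_)
  exact Real.rpow_le_one_of_one_le_of_nonpos (by nlinarith [sq_nonneg ‖ξ‖]) hs

lemma integrableOn_Wsym_mul_convIter {u : ℝ → Edim d → ℂ}
    (hu : Measurable (Function.uncurry u)) {t : ℝ} {b : Edim d → ℝ} {M : ℝ} (hM : 0 ≤ M)
    (hb : Integrable b) (hub : ∀ t' ∈ Ioc 0 t, ∀ ξ, ‖u t' ξ‖ ≤ b ξ) (hbM : ∀ ξ, b ξ ≤ M)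
    (n : ℕ) (ξ : Edim d) :
    IntegrableOn (fun t' => ((Wsym (t - t') ‖ξ‖ : ℝ) : ℂ) * convIter d (u t') n ξ)
      (Ioc 0 t) := by
  have hm : Measurable fun t' => convIter d (u t') n ξ :=
    (measurable_convIter_uncurry hu n).comp measurable_prodMk_right
  have hW : Measurable fun t' => ((Wsym (t - t') ‖ξ‖ : ℝ) : ℂ) := by
    unfold Wsym Psym V1sym; fun_prop
  refine Measure.integrableOn_of_bounded (M := t * (M * (∫ η, b η) ^ n)) (by simp)
    (hW.mul hm).aestronglyMeasurable ?_
  refine ae_restrict_of_forall_mem measurableSet_Ioc fun t' ht' => ?_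
  rw [norm_mul, Complex.norm_real, Real.norm_eq_abs]
  gcongr
  · linarith [ht'.1, ht'.2]
  · exact (abs_Wsym_le (by linarith [ht'.2]) (norm_nonneg _)).trans (by linarith [ht'.1])
  · exact norm_convIter_le hM hb (hub t' ht') hbM n ξ

/-- Duhamel estimate in `L²`, with the difference of two nonlinearities as forcing. -/
lemma eLpNorm_duhamel_sub_le {u v : ℝ → Edim d → ℂ}
    (hu : Measurable (Function.uncurry u)) (hv : Measurable (Function.uncurry v))
    {t : ℝ} (ht : 0 ≤ t) {b : Edim d → ℝ} {M : ℝ} (hM : 0 ≤ M) (hb : Integrable b)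
    (hub : ∀ t' ∈ Ioc 0 t, ∀ ξ, ‖u t' ξ‖ ≤ b ξ) (hvb : ∀ t' ∈ Ioc 0 t, ∀ ξ, ‖v t' ξ‖ ≤ b ξ)
    (hbM : ∀ ξ, b ξ ≤ M) (n : ℕ) :
    eLpNorm (fun ξ =>
        (-∫ t' in (0 : ℝ)..t, ((Wsym (t - t') ‖ξ‖ : ℝ) : ℂ) * convIter d (u t') n ξ) -
          -∫ t' in (0 : ℝ)..t, ((Wsym (t - t') ‖ξ‖ : ℝ) : ℂ) * convIter d (v t') n ξ) 2 ≤
      ∫⁻ t' in Ioc 0 t, ENNReal.ofReal t *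
        eLpNorm (fun ξ => convIter d (u t') n ξ - convIter d (v t') n ξ) 2 := by
  have hD : Measurable (Function.uncurry fun t' ξ =>
      convIter d (u t') n ξ - convIter d (v t') n ξ) :=
    (measurable_convIter_uncurry hu n).sub (measurable_convIter_uncurry hv n)
  simp only [eLpNorm_two_eq]
  calc _ ≤ (∫⁻ ξ, (∫⁻ t' in Ioc 0 t, ENNReal.ofReal t *
          ‖convIter d (u t') n ξ - convIter d (v t') n ξ‖ₑ) ^ 2) ^ (1 / 2 : ℝ) := by
        gcongr with ξ
        have iu := integrableOn_Wsym_mul_convIter hu hM hb hub hbM n ξ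
        have iv := integrableOn_Wsym_mul_convIter hv hM hb hvb hbM n ξ
        rw [← neg_add', enorm_neg, intervalIntegral.integral_of_le ht,
          intervalIntegral.integral_of_le ht, ← sub_eq_add_neg, ← integral_sub iu iv]
        refine (enorm_integral_le_lintegral_enorm _).trans ?_
        refine setLIntegral_mono' measurableSet_Ioc fun t' ht' => ?_
        rw [← mul_sub, enorm_mul]
        gcongr
        rw [← ofReal_norm, Complex.norm_real, Real.norm_eq_abs]
        refine ENNReal.ofReal_le_ofReal ?_
        exact (abs_Wsym_le (by linarith [ht'.2]) (norm_nonneg _)).trans (by linarith [ht'.1])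
    _ ≤ ∫⁻ t' in Ioc 0 t, (∫⁻ ξ, (ENNReal.ofReal t *
          ‖convIter d (u t') n ξ - convIter d (v t') n ξ‖ₑ) ^ 2) ^ (1 / 2 : ℝ) :=
        lintegral_sq_lintegral_le (D := fun t' ξ => ENNReal.ofReal t *
          ‖convIter d (u t') n ξ - convIter d (v t') n ξ‖ₑ) (hD.enorm.const_mul _)
    _ = _ := by
        refine lintegral_congr fun t' => ?_
        simp only [mul_pow]
        rw [lintegral_const_mul' _ _ (by simp), ENNReal.mul_rpow_of_nonneg _ _ (by norm_num),
          ← ENNReal.rpow_two, ← ENNReal.rpow_mul]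
        norm_num

lemma lintegral_one_add_exp_le {t N S : ℝ} (ht : 0 ≤ t) (hN : 0 < N) (hS : 0 ≤ S) :
    ∫⁻ t' in Ioc 0 t, ENNReal.ofReal (1 + S * exp (-(N / 4) * t')) ≤
      ENNReal.ofReal (t + 4 * S / N) := by
  have hd : ∀ x ∈ uIcc 0 t, HasDerivAt (fun x => x - 4 * S / N * exp (-(N / 4) * x))
      (1 + S * exp (-(N / 4) * x)) x := fun x _ => by
    have h := (hasDerivAt_id' x).sub
      ((((hasDerivAt_id' x).const_mul (-(N / 4))).exp).const_mul (4 * S / N))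
    exact h.congr_deriv (by field_simp; ring)
  have hc : Continuous fun x : ℝ => 1 + S * exp (-(N / 4) * x) := by fun_prop
  rw [← ofReal_integral_eq_lintegral_ofReal
    (hc.integrableOn_Ioc) (.of_forall fun x => by positivity),
    ← intervalIntegral.integral_of_le ht,
    intervalIntegral.integral_eq_sub_of_hasDerivAt hd (hc.intervalIntegrable _ _)]
  refine ENNReal.ofReal_le_ofReal ?_
  have : 0 ≤ 4 * S / N * exp (-(N / 4) * t) := by positivity
  simp only [mul_zero, exp_zero]
  linarith

lemma sum_range_pow_le {k : ℕ} (hk : 1 ≤ k) {x e : ℝ} (hx : 0 ≤ x) (he : 0 ≤ e) (he1 : e ≤ 1) :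
    ∑ m ∈ Finset.range k, (8 * x * e) ^ m ≤
      8 ^ k * (1 + (∑ m ∈ Finset.Icc 1 (k - 1), x ^ m) * e) := by
  have hr : Finset.range k = insert 0 (Finset.Icc 1 (k - 1)) := by
    ext m; simp only [Finset.mem_range, Finset.mem_insert, Finset.mem_Icc]; omega
  rw [hr, Finset.sum_insert (by simp), pow_zero, mul_add, mul_one]
  refine add_le_add (one_le_pow₀ (by norm_num)) ?_
  rw [Finset.sum_mul, Finset.mul_sum]
  refine Finset.sum_le_sum fun m hm => ?_
  rw [Finset.mem_Icc] at hm
  rw [mul_pow, mul_pow, mul_assoc]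
  gcongr
  · norm_num
  · omega
  · exact pow_le_of_le_one he he1 (by omega)

end Duhamel

/-- estimate (4.17): in the time regime `N⁻¹ ≪ t ≪ 1`,
`‖Ξ₁(u⃗)(t) - Ξ₁(φ⃗)(t)‖_{H^s} ≤ C((t/N) Σ_{m=1}^{k-1} R^m A^{md} + t²)`, with
`u⃗ = (u₀ + φ, u₁)`, `φ⃗ = (φ,0)`, Schwartz `(u₀,u₁)` of unit size and `φ̂ = R·𝟙_{Ω_k}`. -/
theorem Xi1_difference_bound_long_time
    (d k : ℕ) (hd : 1 ≤ d) (hk : 2 ≤ k) (s : ℝ) (hs : s < 0) :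
    ∃ C δ K : ℝ, 0 < C ∧ 0 < δ ∧ 0 < K ∧
      ∀ F₀ F₁ : SchwartzMap (Edim d) ℂ,
        pairFLNorm d ⇑F₀ ⇑F₁ ≤ 1 → pairHsNorm d 0 ⇑F₀ ⇑F₁ ≤ 1 →
        ∀ A N R : ℝ, 1 ≤ A → A / δ ≤ N → 0 < R →
          ∀ t : ℝ, K / N ≤ t → t ≤ δ →
            HsNorm d s (fun ξ =>
                Xi d k (fun ξ' => F₀ ξ' + phiHatK d k N A R ξ') ⇑F₁ 1 t ξ -
                  Xi d k (phiHatK d k N A R) (fun _ => 0) 1 t ξ) ≤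
              ENNReal.ofReal (C * ((t / N) *
                  (∑ m ∈ Finset.Icc 1 (k - 1), R ^ m * A ^ (m * d)) + t ^ 2)) := by
  refine ⟨4 * 48 ^ k, 1, 1, by positivity, one_pos, one_pos, ?_⟩
  intro F₀ F₁ hFL hHs A N R hA hAN hR t hKt ht1
  rw [div_one] at hAN
  have hA0 : 0 ≤ A := by linarith
  have hN : 0 < N := by linarith
  have ht : 0 ≤ t := le_trans (by positivity) hKt
  have hS : ∑ m ∈ Finset.Icc 1 (k - 1), R ^ m * A ^ (m * d) =
      ∑ m ∈ Finset.Icc 1 (k - 1), (R * A ^ d) ^ m :=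
    Finset.sum_congr rfl fun m _ => by rw [mul_pow, ← pow_mul, mul_comm d]
  rw [hS]
  set S := ∑ m ∈ Finset.Icc 1 (k - 1), (R * A ^ d) ^ m
  have hS0 : 0 ≤ S := Finset.sum_nonneg fun m _ => by positivity
  set f := Vflow d F₀ F₁
  set g := Vflow d (phiHatK d k N A R) (fun _ => 0)
  have hm₀ : Measurable F₀ := F₀.continuous.measurable
  have hm₁ : Measurable F₁ := F₁.continuous.measurable
  have hf : Measurable (Function.uncurry f) := measurable_Vflow hm₀ hm₁
  have hg : Measurable (Function.uncurry g) :=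
    measurable_Vflow (measurable_phiHatK k N A R) measurable_const
  -- time-independent integrable and bounded majorants of the two linear flows
  set b : Edim d → ℝ := fun ξ => 2 * (‖F₀ ξ‖ + ‖F₁ ξ‖)
  set c : Edim d → ℝ := (OmegaKSet d k N A).indicator fun _ => 2 * R
  have hb : Integrable b := (F₀.integrable.norm.add F₁.integrable.norm).const_mul 2
  have hc : Integrable c := (integrable_indicator_iff (measurableSet_OmegaKSet k N A)).2
    (integrableOn_const ((volume_OmegaKSet_le k N hA0).trans_lt ENNReal.ofReal_lt_top).ne)
  have hfb : ∀ t' ∈ Ioc 0 t, ∀ ξ, ‖f t' ξ‖ ≤ b ξ := fun t' ht' ξ => by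
    refine (norm_Vflow_le F₀ F₁ ht'.1.le (ht'.2.trans ht1) ξ).trans ?_
    have : (1 + ‖ξ‖ ^ 2) ^ (-(1 : ℝ) / 2) ≤ 1 :=
      Real.rpow_le_one_of_one_le_of_nonpos (by nlinarith [sq_nonneg ‖ξ‖]) (by norm_num)
    simp only [b]
    gcongr
    exact mul_le_of_le_one_left (norm_nonneg _) this
  have hgc : ∀ t' ∈ Ioc 0 t, ∀ ξ, ‖g t' ξ‖ ≤ c ξ := fun t' ht' ξ => by
    refine (norm_Vflow_phiHatK_le hd k hA0 hAN hR.le ht'.1.le ξ).trans ?_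
    refine indicator_le_indicator (mul_le_of_le_one_right (by positivity) ?_)
    exact Real.exp_le_one_iff.2 (by nlinarith [mul_pos hN ht'.1])
  have hb0 : ∀ ξ, 0 ≤ b ξ := fun ξ => by positivity
  have hc0 : ∀ ξ, 0 ≤ c ξ := fun ξ => indicator_nonneg (fun _ _ => by positivity) ξ
  set M := 2 * (‖F₀.toBoundedContinuousFunction‖ + ‖F₁.toBoundedContinuousFunction‖) + 2 * R
  have hM : 0 ≤ M := by positivity
  have hbc : ∀ ξ, b ξ + c ξ ≤ M := fun ξ => by
    have h0 := F₀.toBoundedContinuousFunction.norm_coe_le_norm ξ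
    have h1 := F₁.toBoundedContinuousFunction.norm_coe_le_norm ξ
    have h2 : c ξ ≤ 2 * R := indicator_le_self' (fun _ _ => by positivity) ξ
    simp only [SchwartzMap.toBoundedContinuousFunction_apply] at h0 h1
    simp only [b, M]
    linarith
  have hpoint : ∀ t' ∈ Ioc 0 t, eLpNorm (fun ξ =>
      convIter d (fun η => f t' η + g t' η) (k - 1) ξ - convIter d (g t') (k - 1) ξ) 2 ≤
      ENNReal.ofReal (48 ^ k) * ENNReal.ofReal (1 + S * exp (-(N / 4) * t')) := by
    intro t' ht'
    have ht'1 := ht'.2.trans ht1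
    have hk1 : k - 1 + 1 = k := by omega
    have h := eLpNorm_convIter_add_sub_le hf.of_uncurry_left hg.of_uncurry_left hM hb hc
      (hfb t' ht') (hgc t' ht') hbc
      ((eLpNorm_one_Vflow_le hm₀ hFL ht'.1.le ht'1).trans (by norm_num))
      (eLpNorm_two_Vflow_le hm₀ hHs ht'.1.le ht'1)
      (eLpNorm_one_Vflow_phiHatK_le hd k hA0 hAN hR.le ht'.1.le) (k - 1)
    have he1 : exp (-(N / 4) * t') ≤ 1 :=
      Real.exp_le_one_iff.2 (by nlinarith [mul_pos hN ht'.1])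
    have h6 : (4 + 2 : ℝ≥0∞) = ENNReal.ofReal 6 := by norm_num
    rw [hk1, h6, ← ENNReal.ofReal_pow (by norm_num),
      Finset.sum_congr rfl fun m _ => (ENNReal.ofReal_pow (by positivity) m).symm,
      ← ENNReal.ofReal_sum_of_nonneg fun m _ => by positivity,
      ← ENNReal.ofReal_mul (by positivity)] at h
    refine h.trans ?_
    rw [← ENNReal.ofReal_mul (by positivity)]
    refine ENNReal.ofReal_le_ofReal ?_
    calc _ ≤ (6 : ℝ) ^ k * (8 ^ k * (1 + S * exp (-(N / 4) * t'))) := by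
          gcongr
          exact sum_range_pow_le (by omega) (by positivity) (by positivity) he1
      _ = _ := by rw [← mul_assoc, ← mul_pow]; norm_num
  simp only [Xi_one (by omega : 1 ≤ k)]
  simp_rw [Vflow_add]
  calc _ ≤ _ := HsNorm_le_eLpNorm hs.le _
    _ ≤ _ := eLpNorm_duhamel_sub_le (u := fun t' η => f t' η + g t' η) (hf.add hg) hg ht hM
        (hb.add hc) (fun t' ht' ξ => (norm_add_le _ _).trans
          (add_le_add (hfb t' ht' ξ) (hgc t' ht' ξ)))
        (fun t' ht' ξ => (hgc t' ht' ξ).trans (le_add_of_nonneg_left (hb0 ξ))) hbc (k - 1)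
    _ ≤ ∫⁻ t' in Ioc 0 t, ENNReal.ofReal t *
          (ENNReal.ofReal (48 ^ k) * ENNReal.ofReal (1 + S * exp (-(N / 4) * t'))) :=
        setLIntegral_mono' measurableSet_Ioc fun t' ht' => by
          gcongr
          exact hpoint t' ht'
    _ = ENNReal.ofReal t * (ENNReal.ofReal (48 ^ k) *
          ∫⁻ t' in Ioc 0 t, ENNReal.ofReal (1 + S * exp (-(N / 4) * t'))) := by
        rw [lintegral_const_mul' _ _ (by simp), lintegral_const_mul' _ _ (by simp)]
    _ ≤ ENNReal.ofReal t * (ENNReal.ofReal (48 ^ k) * ENNReal.ofReal (t + 4 * S / N)) := by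
        gcongr
        exact lintegral_one_add_exp_le ht hN hS0
    _ ≤ _ := by
        rw [← ENNReal.ofReal_mul (by positivity), ← ENNReal.ofReal_mul ht]
        refine ENNReal.ofReal_le_ofReal ?_
        have h48 : (0 : ℝ) ≤ 48 ^ k * t ^ 2 := by positivity
        calc t * (48 ^ k * (t + 4 * S / N))
            = 4 * 48 ^ k * (t / N * S) + 48 ^ k * t ^ 2 := by ring
          _ ≤ _ := by linarith

end
end

section
/- Let d ≥ 1 and s ∈ ℝ. There exist constants c, C > 0, depending only on d and s, such that for all t with 0 < t ≤ 1/2 and all A with A·t ≥ 8: (i) c · t · g_s(1/t) ≤ ( ∫_{Q_A} ⟨ξ⟩^{2s} e^{−|ξ|t} · ( sin((√3/2)t|ξ|) / ((√3/2)|ξ|) )² dξ )^{1/2} ≤ C · t · g_s(1/t); and (ii) ( ∫_{ℝ^d} ⟨ξ⟩^{2s} e^{−|ξ|t} dξ )^{1/2} ≤ C · g_s(1/t). -/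
open MeasureTheory Real Set Filter Topology
open scoped ENNReal NNReal BigOperators

noncomputable section

section Radial

variable {E : Type*} [NormedAddCommGroup E] [NormedSpace ℝ E] [FiniteDimensional ℝ E]
  [MeasurableSpace E] [BorelSpace E] [Nontrivial E]

/-- Polar coordinates for the lower Lebesgue integral of a radial function. -/
theorem lintegral_fun_norm_addHaar (μ : Measure E) [μ.IsAddHaarMeasure] {f : ℝ → ℝ≥0∞}
    (hf : Measurable f) :
    ∫⁻ x, f ‖x‖ ∂μ = μ.toSphere univ *
      ∫⁻ y in Ioi (0 : ℝ), ENNReal.ofReal (y ^ (Module.finrank ℝ E - 1)) * f y :=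
  calc
    ∫⁻ x, f ‖x‖ ∂μ = ∫⁻ x : ({(0)}ᶜ : Set E), f ‖x.1‖ ∂(μ.comap (↑)) := by
      rw [lintegral_subtype_comap (measurableSet_singleton _).compl fun x ↦ f ‖x‖,
        restrict_compl_singleton]
    _ = ∫⁻ x, f x.2 ∂μ.toSphere.prod (.volumeIoiPow (Module.finrank ℝ E - 1)) := by
      simpa using μ.measurePreserving_homeomorphUnitSphereProd.lintegral_comp
        (f := fun x ↦ f x.2) (by fun_prop)
    _ = μ.toSphere univ *
        ∫⁻ x : Ioi (0 : ℝ), f x ∂.volumeIoiPow (Module.finrank ℝ E - 1) := by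
      rw [lintegral_prod _ (by fun_prop)]
      simp only [lintegral_const, mul_comm]
    _ = _ := by
      rw [Measure.volumeIoiPow, lintegral_withDensity_eq_lintegral_mul _ (by fun_prop)
        (by fun_prop)]
      congr 1
      exact lintegral_subtype_comap measurableSet_Ioi
        fun y ↦ ENNReal.ofReal (y ^ (Module.finrank ℝ E - 1)) * f y

end Radial

theorem rpow_le_two_rpow_abs_mul {x y : ℝ} (s : ℝ) (hx : 0 < x) (hxy : x ≤ y) (hy : y ≤ 2 * x) :
    y ^ s ≤ 2 ^ |s| * x ^ s := by
  have hq : 1 ≤ y / x := (one_le_div hx).2 hxy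
  have hq' : y / x ≤ 2 := (div_le_iff₀ hx).2 hy
  calc y ^ s = (y / x) ^ s * x ^ s := by
        rw [← mul_rpow (by positivity) hx.le, div_mul_cancel₀ _ hx.ne']
    _ ≤ 2 ^ |s| * x ^ s := by
        gcongr
        exact (rpow_le_rpow_of_exponent_le hq (le_abs_self s)).trans
          (rpow_le_rpow (by positivity) hq' (abs_nonneg s))

theorem two_rpow_neg_abs_mul_le_rpow {x y : ℝ} (s : ℝ) (hx : 0 < x) (hxy : x ≤ y)
    (hy : y ≤ 2 * x) : 2 ^ (-|s|) * x ^ s ≤ y ^ s := by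
  have hy0 : 0 < y := hx.trans_le hxy
  have h := rpow_le_two_rpow_abs_mul (-s) hx hxy hy
  rw [abs_neg, rpow_neg hy0.le, rpow_neg hx.le, ← div_eq_mul_inv,
    inv_le_comm₀ (by positivity) (by positivity), inv_div] at h
  rwa [rpow_neg zero_le_two, inv_mul_eq_div]

theorem gs_sq (d : ℕ) (s : ℝ) {T : ℝ} (hT : 0 < T) :
    gs d s T ^ 2 = if d + 2 * s < 0 then 1
      else if d + 2 * s = 0 then log (√(1 + T ^ 2)) else T ^ (d + 2 * s) := by
  unfold gs
  rcases lt_trichotomy ((d : ℝ) + 2 * s) 0 with h | h | h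
  · rw [if_pos (by linarith), if_pos h, one_pow]
  · rw [if_neg (by linarith), if_pos (by linarith), if_neg (by linarith), if_pos h,
      sq_sqrt (log_nonneg (one_le_sqrt.2 (by nlinarith)))]
  · rw [if_neg (by linarith), if_neg (by linarith), if_neg (by linarith), if_neg h.ne',
      ← rpow_natCast, ← rpow_mul hT.le]
    congr 1
    push_cast
    ring

theorem gs_nonneg (d : ℕ) (s : ℝ) {T : ℝ} (hT : 0 < T) : 0 ≤ gs d s T := by
  unfold gs
  split_ifs <;> positivity

theorem half_le_gs_sq (d : ℕ) (s : ℝ) {T : ℝ} (hT : 2 ≤ T) : 1 / 2 ≤ gs d s T ^ 2 := by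
  rw [gs_sq d s (by linarith)]
  split_ifs with h h'
  · norm_num
  · have h2 : log 2 ≤ log (√(1 + T ^ 2)) :=
      log_le_log (by norm_num) (le_sqrt_of_sq_le (by nlinarith))
    linarith [log_two_gt_d9]
  · have := one_le_rpow (show (1 : ℝ) ≤ T by linarith)
      (show 0 ≤ d + 2 * s from not_lt.1 h)
    linarith

theorem log_sqrt_one_add_sq_le {T : ℝ} (hT : 2 ≤ T) : log (√(1 + T ^ 2)) ≤ 2 * log T := by
  have h : √(1 + T ^ 2) ≤ T ^ 2 :=
    sqrt_le_iff.2 ⟨by positivity, by nlinarith [show 4 ≤ T ^ 2 by nlinarith]⟩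
  calc log (√(1 + T ^ 2)) ≤ log (T ^ 2) := log_le_log (by positivity) h
    _ = 2 * log T := by rw [log_pow]; norm_num

theorem log_le_log_sqrt_one_add_sq {T : ℝ} (hT : 0 < T) : log T ≤ log (√(1 + T ^ 2)) :=
  log_le_log hT (le_sqrt_of_sq_le (by linarith))

theorem lintegral_Ioc_rpow {a T : ℝ} (hT : 1 ≤ T) :
    ∫⁻ r in Ioc 1 T, ENNReal.ofReal (r ^ (a - 1)) =
      ENNReal.ofReal (if a = 0 then log T else (T ^ a - 1) / a) := by
  have h0 : (0 : ℝ) ∉ uIcc 1 T := notMem_uIcc_of_lt one_pos (by linarith)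
  have hintegrable : IntervalIntegrable (fun r : ℝ ↦ r ^ (a - 1)) volume 1 T :=
    intervalIntegral.intervalIntegrable_rpow (Or.inr h0)
  rw [← ofReal_integral_eq_lintegral_ofReal hintegrable.1, ← intervalIntegral.integral_of_le hT]
  · congr 1
    split_ifs with ha
    · simp only [ha, zero_sub, rpow_neg_one]
      rw [integral_inv_of_pos one_pos (by linarith), div_one]
    · rw [integral_rpow (Or.inr ⟨fun h ↦ ha (by linarith), h0⟩)]
      simp
  · filter_upwards [ae_restrict_mem measurableSet_Ioc] with r hr
    exact rpow_nonneg (by linarith [hr.1]) _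

theorem lintegral_Ioc_rpow_ge_gs_sq (d : ℕ) (s : ℝ) : ∃ c : ℝ, 0 < c ∧ ∀ T : ℝ, 2 ≤ T →
    ENNReal.ofReal (c * gs d s T ^ 2) ≤
      ∫⁻ r in Ioc 1 T, ENNReal.ofReal (r ^ (d + 2 * s - 1)) := by
  set a : ℝ := d + 2 * s with ha
  rcases lt_trichotomy a 0 with h | h | h
  · have h2 : (2 : ℝ) ^ a < 1 := rpow_lt_one_of_one_lt_of_neg one_lt_two h
    refine ⟨(2 ^ a - 1) / a, div_pos_of_neg_of_neg (by linarith) h, fun T hT ↦ ?_⟩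
    rw [lintegral_Ioc_rpow (by linarith), gs_sq d s (by linarith), if_pos h, if_neg h.ne, mul_one]
    gcongr ENNReal.ofReal ?_
    have : T ^ a ≤ 2 ^ a := rpow_le_rpow_of_nonpos two_pos hT h.le
    exact div_le_div_of_nonpos_of_le h.le (by linarith)
  · refine ⟨1 / 2, by norm_num, fun T hT ↦ ?_⟩
    rw [lintegral_Ioc_rpow (by linarith), gs_sq d s (by linarith), if_neg (by linarith),
      if_pos h, if_pos h]
    gcongr
    linarith [log_sqrt_one_add_sq_le hT]
  · have h2 : (2 : ℝ) ^ (-a) < 1 := rpow_lt_one_of_one_lt_of_neg one_lt_two (by linarith)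
    refine ⟨(1 - 2 ^ (-a)) / a, div_pos (by linarith) h, fun T hT ↦ ?_⟩
    rw [lintegral_Ioc_rpow (by linarith), gs_sq d s (by linarith), if_neg (by linarith),
      if_neg h.ne', if_neg h.ne', div_mul_eq_mul_div]
    gcongr
    have : (2 : ℝ) ^ a ≤ T ^ a := rpow_le_rpow two_pos.le hT h.le
    have h1 : (1 : ℝ) ≤ 2 ^ (-a) * T ^ a := by
      rw [rpow_neg two_pos.le, ← div_eq_inv_mul]
      exact (one_le_div (by positivity)).2 this
    linarith

theorem lintegral_Ioi_rpow_mul_exp_le_gs_sq (d : ℕ) (s : ℝ) : ∃ C : ℝ, 0 < C ∧ ∀ T : ℝ, 2 ≤ T →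
    ∫⁻ r in Ioi 1, ENNReal.ofReal (r ^ (d + 2 * s - 1) * exp (-(r / T))) ≤
      ENNReal.ofReal (C * gs d s T ^ 2) := by
  set a : ℝ := d + 2 * s with ha
  rcases lt_trichotomy a 0 with h | h | h
  · refine ⟨-1 / a, div_pos_of_neg_of_neg (by norm_num) h, fun T hT ↦ ?_⟩
    rw [gs_sq d s (by linarith), if_pos h, mul_one]
    have hintegrable := integrableOn_Ioi_rpow_of_lt (show a - 1 < -1 by linarith) one_pos
    have hval := integral_Ioi_rpow_of_lt (show a - 1 < -1 by linarith) one_pos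
    rw [sub_add_cancel, one_rpow] at hval
    rw [← hval, ofReal_integral_eq_lintegral_ofReal hintegrable]
    · refine setLIntegral_mono' measurableSet_Ioi fun r hr ↦ ?_
      have hr : 1 < r := hr
      gcongr
      refine mul_le_of_le_one_right (by positivity) (exp_le_one_iff.2 ?_)
      have : 0 ≤ r / T := by positivity
      linarith
    · filter_upwards [ae_restrict_mem measurableSet_Ioi] with r hr
      have hr : 1 < r := hr
      positivity
  · refine ⟨3, by norm_num, fun T hT ↦ ?_⟩
    have hT0 : 0 < T := by linarith
    have hnear : ∫⁻ r in Ioc 1 T, ENNReal.ofReal (r ^ (a - 1) * exp (-(r / T))) ≤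
        ENNReal.ofReal (log T) := by
      rw [← if_pos h (t := log T) (e := (T ^ a - 1) / a), ← lintegral_Ioc_rpow (by linarith)]
      refine setLIntegral_mono' measurableSet_Ioc fun r hr ↦ ?_
      have hr : 1 < r := hr.1
      gcongr
      refine mul_le_of_le_one_right (by positivity) (exp_le_one_iff.2 ?_)
      have : 0 ≤ r / T := by positivity
      linarith
    have hfar : ∫⁻ r in Ioi T, ENNReal.ofReal (r ^ (a - 1) * exp (-(r / T))) ≤
        ENNReal.ofReal 1 := by
      have hneg : -T⁻¹ < 0 := by simpa using hT0
      have hintegrable := (integrableOn_exp_mul_Ioi hneg T).const_mul T⁻¹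
      have hval := integral_exp_mul_Ioi hneg T
      calc _ ≤ ∫⁻ r in Ioi T, ENNReal.ofReal (T⁻¹ * exp (-T⁻¹ * r)) := by
            refine setLIntegral_mono' measurableSet_Ioi fun r hr ↦ ?_
            have hr : T < r := hr
            rw [h, zero_sub, rpow_neg_one, show -(r / T) = -T⁻¹ * r by ring]
            gcongr
        _ = ENNReal.ofReal (exp (-1)) := by
            rw [← ofReal_integral_eq_lintegral_ofReal hintegrable (ae_of_all _ fun r ↦ by positivity),
              integral_const_mul, hval]
            congr 1
            field_simp
        _ ≤ _ := by
            gcongr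
            exact exp_le_one_iff.2 (by norm_num)
    rw [← Ioc_union_Ioi_eq_Ioi (show 1 ≤ T by linarith)]
    refine (lintegral_union_le _ _ _).trans ((add_le_add hnear hfar).trans ?_)
    rw [← ENNReal.ofReal_add (log_nonneg (by linarith)) zero_le_one]
    gcongr
    have h1 := half_le_gs_sq d s hT
    have h2 : log T ≤ gs d s T ^ 2 := by
      rw [gs_sq d s hT0, if_neg (by linarith), if_pos h]
      exact log_le_log_sqrt_one_add_sq hT0
    linarith
  · refine ⟨Gamma a, Gamma_pos_of_pos h, fun T hT ↦ ?_⟩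
    have hT0 : 0 < T := by linarith
    have hval := integral_rpow_mul_exp_neg_mul_Ioi h (inv_pos.2 hT0)
    have hintegrable : IntegrableOn (fun r ↦ r ^ (a - 1) * exp (-(T⁻¹ * r))) (Ioi 0) :=
      .of_integral_ne_zero (by rw [hval]; have := Gamma_pos_of_pos h; positivity)
    rw [gs_sq d s hT0, if_neg (by linarith), if_neg h.ne', mul_comm]
    rw [one_div, inv_inv] at hval
    rw [← hval, ofReal_integral_eq_lintegral_ofReal hintegrable]
    · simp only [div_eq_inv_mul]
      exact lintegral_mono_set (Ioi_subset_Ioi zero_le_one)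
    · filter_upwards [ae_restrict_mem measurableSet_Ioi] with r hr
      have hr : 0 < r := hr
      positivity

theorem pow_pred_mul_sq_rpow {d : ℕ} (hd : 1 ≤ d) (s : ℝ) {r : ℝ} (hr : 0 < r) :
    r ^ (d - 1) * (r ^ 2) ^ s = r ^ (d + 2 * s - 1) := by
  rw [← rpow_natCast, ← rpow_natCast, ← rpow_mul hr.le, ← rpow_add hr]
  congr 1
  push_cast [hd]
  ring

theorem lintegral_Ioi_radial_le_gs_sq {d : ℕ} (hd : 1 ≤ d) (s : ℝ) :
    ∃ C : ℝ, 0 < C ∧ ∀ T : ℝ, 2 ≤ T →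
      ∫⁻ r in Ioi 0, ENNReal.ofReal (r ^ (d - 1)) *
          ENNReal.ofReal ((1 + r ^ 2) ^ s * exp (-(r / T))) ≤
        ENNReal.ofReal (C * gs d s T ^ 2) := by
  obtain ⟨C, hC, hCT⟩ := lintegral_Ioi_rpow_mul_exp_le_gs_sq d s
  refine ⟨2 ^ |s| * 2 + 2 ^ |s| * C, by positivity, fun T hT ↦ ?_⟩
  have hnear : ∫⁻ r in Ioc 0 1, ENNReal.ofReal (r ^ (d - 1)) *
      ENNReal.ofReal ((1 + r ^ 2) ^ s * exp (-(r / T))) ≤ ENNReal.ofReal (2 ^ |s|) := by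
    calc _ ≤ ∫⁻ r in Ioc (0 : ℝ) 1, ENNReal.ofReal (2 ^ |s|) := by
          refine setLIntegral_mono' measurableSet_Ioc fun r ⟨hr0, hr1⟩ ↦ ?_
          rw [← ENNReal.ofReal_mul (by positivity)]
          gcongr
          have h1 : r ^ (d - 1) ≤ 1 := pow_le_one₀ hr0.le hr1
          have h2 := rpow_le_two_rpow_abs_mul s one_pos (show 1 ≤ 1 + r ^ 2 by nlinarith)
            (by nlinarith)
          rw [one_rpow, mul_one] at h2
          have h3 : exp (-(r / T)) ≤ 1 := exp_le_one_iff.2 (by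
            have : 0 ≤ r / T := by positivity
            linarith)
          calc _ ≤ 1 * ((2 : ℝ) ^ |s| * 1) := by gcongr
            _ = _ := by ring
      _ = _ := by simp
  have hfar : ∫⁻ r in Ioi 1, ENNReal.ofReal (r ^ (d - 1)) *
      ENNReal.ofReal ((1 + r ^ 2) ^ s * exp (-(r / T))) ≤
        ENNReal.ofReal (2 ^ |s|) * ENNReal.ofReal (C * gs d s T ^ 2) := by
    refine le_trans ?_ (mul_le_mul_right (hCT T hT) _)
    rw [← lintegral_const_mul' _ _ ENNReal.ofReal_ne_top]
    refine setLIntegral_mono' measurableSet_Ioi fun r hr ↦ ?_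
    have hr : 1 < r := hr
    have hr0 : 0 < r := by linarith
    rw [← ENNReal.ofReal_mul (by positivity), ← ENNReal.ofReal_mul (by positivity),
      ← pow_pred_mul_sq_rpow hd s hr0]
    gcongr ENNReal.ofReal ?_
    calc _ ≤ r ^ (d - 1) * (2 ^ |s| * (r ^ 2) ^ s * exp (-(r / T))) := by
          gcongr
          exact rpow_le_two_rpow_abs_mul s (by positivity) (by linarith) (by nlinarith)
      _ = _ := by ring
  rw [← Ioc_union_Ioi_eq_Ioi (zero_le_one' ℝ)]
  refine (lintegral_union_le _ _ _).trans ((add_le_add hnear hfar).trans ?_)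
  rw [← ENNReal.ofReal_mul (by positivity), ← ENNReal.ofReal_add (by positivity) (by positivity)]
  gcongr
  have := mul_le_mul_of_nonneg_left (half_le_gs_sq d s hT)
    (show (0 : ℝ) ≤ 2 ^ |s| * 2 by positivity)
  linarith

theorem lintegral_Ioc_radial_ge_gs_sq {d : ℕ} (hd : 1 ≤ d) (s : ℝ) :
    ∃ c : ℝ, 0 < c ∧ ∀ T : ℝ, 2 ≤ T → ENNReal.ofReal (c * gs d s T ^ 2) ≤
      ∫⁻ r in Ioc 1 T, ENNReal.ofReal (r ^ (d - 1)) * ENNReal.ofReal ((1 + r ^ 2) ^ s) := by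
  obtain ⟨c, hc, hcT⟩ := lintegral_Ioc_rpow_ge_gs_sq d s
  refine ⟨2 ^ (-|s|) * c, by positivity, fun T hT ↦ ?_⟩
  rw [mul_assoc, ENNReal.ofReal_mul (by positivity)]
  refine (mul_le_mul_right (hcT T hT) _).trans ?_
  rw [← lintegral_const_mul' _ _ ENNReal.ofReal_ne_top]
  refine setLIntegral_mono' measurableSet_Ioc fun r hr ↦ ?_
  have hr : 1 < r := hr.1
  have hr0 : 0 < r := by linarith
  rw [← ENNReal.ofReal_mul (by positivity), ← ENNReal.ofReal_mul (by positivity),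
    ← pow_pred_mul_sq_rpow hd s hr0]
  gcongr ENNReal.ofReal ?_
  calc _ = r ^ (d - 1) * (2 ^ (-|s|) * (r ^ 2) ^ s) := by ring
    _ ≤ _ := by
      gcongr
      exact two_rpow_neg_abs_mul_le_rpow s (by positivity) (by linarith) (by nlinarith)

theorem lintegral_bracket_mul_exp_le_gs_sq {d : ℕ} (hd : 1 ≤ d) (s : ℝ) :
    ∃ C : ℝ, 0 < C ∧ ∀ T : ℝ, 2 ≤ T →
      ∫⁻ ξ : Edim d, ENNReal.ofReal ((1 + ‖ξ‖ ^ 2) ^ s * exp (-(‖ξ‖ / T))) ≤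
        ENNReal.ofReal (C * gs d s T ^ 2) := by
  obtain ⟨C, hC, hCT⟩ := lintegral_Ioi_radial_le_gs_sq hd s
  have : Nonempty (Fin d) := ⟨⟨0, hd⟩⟩
  set K := (volume : Measure (Edim d)).toSphere univ with hK
  have hKtop : K ≠ ⊤ := measure_ne_top _ _
  have hK0 : K ≠ 0 :=
    Measure.measure_univ_ne_zero.2 (Measure.toSphere_ne_zero _)
  refine ⟨K.toReal * C, mul_pos (ENNReal.toReal_pos hK0 hKtop) hC, fun T hT ↦ ?_⟩
  rw [lintegral_fun_norm_addHaar volume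
    (f := fun r ↦ ENNReal.ofReal ((1 + r ^ 2) ^ s * exp (-(r / T)))) (by fun_prop),
    finrank_euclideanSpace_fin, mul_assoc, ENNReal.ofReal_mul ENNReal.toReal_nonneg,
    ENNReal.ofReal_toReal hKtop]
  exact mul_le_mul_right (hCT T hT) _

theorem lintegral_annulus_bracket_ge_gs_sq {d : ℕ} (hd : 1 ≤ d) (s : ℝ) :
    ∃ c : ℝ, 0 < c ∧ ∀ T : ℝ, 2 ≤ T → ENNReal.ofReal (c * gs d s T ^ 2) ≤
      ∫⁻ ξ in {ξ : Edim d | ‖ξ‖ ∈ Ioc 1 T}, ENNReal.ofReal ((1 + ‖ξ‖ ^ 2) ^ s) := by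
  obtain ⟨c, hc, hcT⟩ := lintegral_Ioc_radial_ge_gs_sq hd s
  have : Nonempty (Fin d) := ⟨⟨0, hd⟩⟩
  set K := (volume : Measure (Edim d)).toSphere univ with hK
  have hKtop : K ≠ ⊤ := measure_ne_top _ _
  have hK0 : K ≠ 0 :=
    Measure.measure_univ_ne_zero.2 (Measure.toSphere_ne_zero _)
  refine ⟨K.toReal * c, mul_pos (ENNReal.toReal_pos hK0 hKtop) hc, fun T hT ↦ ?_⟩
  have hmeas : MeasurableSet {ξ : Edim d | ‖ξ‖ ∈ Ioc 1 T} := measurable_norm measurableSet_Ioc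
  set f : ℝ → ℝ≥0∞ := (Ioc 1 T).indicator fun r ↦ ENNReal.ofReal ((1 + r ^ 2) ^ s) with hf
  have hfm : Measurable f := Measurable.indicator (by fun_prop) measurableSet_Ioc
  have hpolar : ∫⁻ ξ in {ξ : Edim d | ‖ξ‖ ∈ Ioc 1 T}, ENNReal.ofReal ((1 + ‖ξ‖ ^ 2) ^ s) =
      ∫⁻ ξ : Edim d, f ‖ξ‖ := by
    rw [← lintegral_indicator hmeas]
    rfl
  rw [hpolar, lintegral_fun_norm_addHaar volume hfm, finrank_euclideanSpace_fin, mul_assoc,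
    ENNReal.ofReal_mul ENNReal.toReal_nonneg, ENNReal.ofReal_toReal hKtop]
  refine mul_le_mul_right ((hcT T hT).trans ?_) _
  calc _ = ∫⁻ r in Ioc 1 T, ENNReal.ofReal (r ^ (d - 1)) * f r :=
        setLIntegral_congr_fun measurableSet_Ioc fun r hr ↦ by rw [hf, indicator_of_mem hr]
    _ ≤ _ := lintegral_mono_set fun r hr ↦ zero_lt_one.trans hr.1

theorem sq_sin_div_le (b t r : ℝ) : (sin (b * t * r) / (b * r)) ^ 2 ≤ t ^ 2 := by
  rcases eq_or_ne (b * r) 0 with h | h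
  · rw [h, div_zero, zero_pow two_ne_zero]
    positivity
  · rw [sq_le_sq, abs_div, div_le_iff₀ (abs_pos.2 h), ← abs_mul]
    exact abs_sin_le_abs.trans_eq (by ring_nf)

theorem le_sq_sin_div {b t r : ℝ} (hb : 0 < b) (hr : 0 < r) (ht : 0 < t) (h : b * t * r ≤ 1) :
    t ^ 2 / 4 ≤ (sin (b * t * r) / (b * r)) ^ 2 := by
  have hsin := mul_le_sin (x := b * t * r) (by positivity) (by linarith [pi_gt_three])
  have hpi : 1 / 2 ≤ 2 / π := by
    rw [div_le_div_iff₀ two_pos pi_pos]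
    linarith [pi_lt_four]
  have hle : t / 2 ≤ sin (b * t * r) / (b * r) := by
    rw [le_div_iff₀ (by positivity)]
    calc t / 2 * (b * r) = 1 / 2 * (b * t * r) := by ring
      _ ≤ 2 / π * (b * t * r) := by gcongr
      _ ≤ _ := hsin
  calc t ^ 2 / 4 = (t / 2) ^ 2 := by ring
    _ ≤ _ := by gcongr

theorem rpow_half_le_ofReal {x : ℝ≥0∞} {y : ℝ} (hy : 0 ≤ y) (h : x ≤ ENNReal.ofReal (y ^ 2)) :
    x ^ (1 / 2 : ℝ) ≤ ENNReal.ofReal y := by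
  refine (ENNReal.rpow_le_rpow h (by norm_num)).trans_eq ?_
  rw [ENNReal.ofReal_rpow_of_nonneg (by positivity) (by norm_num), ← sqrt_eq_rpow, sqrt_sq hy]

theorem ofReal_le_rpow_half {x : ℝ≥0∞} {y : ℝ} (hy : 0 ≤ y) (h : ENNReal.ofReal (y ^ 2) ≤ x) :
    ENNReal.ofReal y ≤ x ^ (1 / 2 : ℝ) := by
  refine Eq.trans_le ?_ (ENNReal.rpow_le_rpow h (by norm_num))
  rw [ENNReal.ofReal_rpow_of_nonneg (by positivity) (by norm_num), ← sqrt_eq_rpow, sqrt_sq hy]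

/-- the computations of `D₁(t,A)` and `D₂(t,A)` in the proof of
Proposition 4.2: for `0 < t ≤ 1/2` and `At ≥ 8`,
`(∫_{Q_A} ⟨ξ⟩^{2s} e^{-|ξ|t} (sin((√3/2)t|ξ|)/((√3/2)|ξ|))² dξ)^{1/2} ∼ t g_s(1/t)` and
`(∫_{ℝ^d} ⟨ξ⟩^{2s} e^{-|ξ|t} dξ)^{1/2} ≲ g_s(1/t)`. -/
theorem D1_D2_estimates
    (d : ℕ) (hd : 1 ≤ d) (s : ℝ) :
    ∃ c C : ℝ, 0 < c ∧ 0 < C ∧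
      ∀ t A : ℝ, 0 < t → t ≤ 1 / 2 → 8 ≤ A * t →
        (ENNReal.ofReal (c * t * gs d s (1 / t)) ≤
          (∫⁻ ξ in cubeSet d A, ENNReal.ofReal ((1 + ‖ξ‖ ^ 2) ^ s *
              Real.exp (-(‖ξ‖ * t)) *
              (Real.sin (Real.sqrt 3 / 2 * t * ‖ξ‖) / (Real.sqrt 3 / 2 * ‖ξ‖)) ^ 2)) ^
            (1 / 2 : ℝ)) ∧
        ((∫⁻ ξ in cubeSet d A, ENNReal.ofReal ((1 + ‖ξ‖ ^ 2) ^ s *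
              Real.exp (-(‖ξ‖ * t)) *
              (Real.sin (Real.sqrt 3 / 2 * t * ‖ξ‖) / (Real.sqrt 3 / 2 * ‖ξ‖)) ^ 2)) ^
            (1 / 2 : ℝ) ≤ ENNReal.ofReal (C * t * gs d s (1 / t))) ∧
        ((∫⁻ ξ : Edim d, ENNReal.ofReal ((1 + ‖ξ‖ ^ 2) ^ s *
              Real.exp (-(‖ξ‖ * t)))) ^ (1 / 2 : ℝ) ≤
          ENNReal.ofReal (C * gs d s (1 / t))) := by

  obtain ⟨C, hC, hCT⟩ := lintegral_bracket_mul_exp_le_gs_sq hd s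
  obtain ⟨c, hc, hcT⟩ := lintegral_annulus_bracket_ge_gs_sq hd s
  refine ⟨√(exp (-1) / 4 * c), √C, by positivity, by positivity, fun t A ht ht2 hA ↦ ?_⟩
  have hT : 2 ≤ 1 / t := by
    rw [le_div_iff₀ ht]
    linarith
  have hg := gs_nonneg d s (T := 1 / t) (by positivity)
  have hupper := hCT _ hT
  simp only [div_div_eq_mul_div, div_one] at hupper
  refine ⟨ofReal_le_rpow_half (by positivity) ?_, rpow_half_le_ofReal (by positivity) ?_,
    rpow_half_le_ofReal (by positivity) ?_⟩
  · have hsub : {ξ : Edim d | ‖ξ‖ ∈ Ioc 1 (1 / t)} ⊆ cubeSet d A := fun ξ hξ i ↦ by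
      have hA' : 1 / t ≤ A / 8 := by
        rw [div_le_div_iff₀ ht (by norm_num)]
        linarith
      exact (PiLp.norm_apply_le ξ i).trans (hξ.2.trans hA')
    refine le_trans ?_ (lintegral_mono_set hsub)
    calc _ = ENNReal.ofReal (exp (-1) * (t ^ 2 / 4)) *
          ENNReal.ofReal (c * gs d s (1 / t) ^ 2) := by
          rw [← ENNReal.ofReal_mul (by positivity), mul_pow, mul_pow, sq_sqrt (by positivity)]
          congr 1
          ring
      _ ≤ _ := mul_le_mul_right (hcT _ hT) _
      _ ≤ _ := by
          rw [← lintegral_const_mul' _ _ ENNReal.ofReal_ne_top]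
          refine setLIntegral_mono' (measurable_norm measurableSet_Ioc) fun ξ ⟨h1, h2⟩ ↦ ?_
          have hr : 0 < ‖ξ‖ := zero_lt_one.trans h1
          have hrt : ‖ξ‖ * t ≤ 1 := (le_div_iff₀ ht).1 h2
          have hb : √3 / 2 ≤ 1 := by
            rw [div_le_one two_pos]
            exact sqrt_le_iff.2 ⟨by norm_num, by norm_num⟩
          have hsin := le_sq_sin_div (b := √3 / 2) (by positivity) hr ht (by
            calc √3 / 2 * t * ‖ξ‖ = √3 / 2 * (‖ξ‖ * t) := by ring
              _ ≤ 1 * 1 := by gcongr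
              _ = 1 := one_mul 1)
          rw [← ENNReal.ofReal_mul (by positivity), mul_comm (_ * _), ← mul_assoc]
          gcongr
  · calc _ ≤ ∫⁻ ξ : Edim d, ENNReal.ofReal (t ^ 2) *
          ENNReal.ofReal ((1 + ‖ξ‖ ^ 2) ^ s * exp (-(‖ξ‖ * t))) := by
          refine (setLIntegral_le_lintegral _ _).trans (lintegral_mono fun ξ ↦ ?_)
          rw [← ENNReal.ofReal_mul (by positivity), mul_comm (t ^ 2)]
          gcongr ENNReal.ofReal (_ * ?_)
          exact sq_sin_div_le _ _ _
      _ ≤ ENNReal.ofReal (t ^ 2) * ENNReal.ofReal (C * gs d s (1 / t) ^ 2) := by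
          rw [lintegral_const_mul' _ _ ENNReal.ofReal_ne_top]
          exact mul_le_mul_right hupper _
      _ = _ := by
          rw [← ENNReal.ofReal_mul (by positivity), mul_pow, mul_pow, sq_sqrt hC.le]
          congr 1
          ring
  · rwa [mul_pow, sq_sqrt hC.le]

end
end

section
/- Let k ≥ 2 be an integer. There exists a constant C > 0, depending only on k, such that for every integer j ≥ 1: Σ 1 / ( (l₁+1)² (l₂+1) (l₃+1) ⋯ (l_k+1) ) ≤ C, where the sum ranges over all k-tuples (l₁,…,l_k) of nonnegative integers with l₁ + ⋯ + l_k = j − 1. -/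
open MeasureTheory Real Set Filter Topology
open scoped ENNReal NNReal BigOperators

noncomputable section

/-- Splitting off the first entry of the tuples of sum `n`. -/
lemma sum_antidiagonalTuple_succ {M : Type*} [AddCommMonoid M] (m n : ℕ)
    (f : (Fin (m + 1) → ℕ) → M) :
    ∑ l ∈ Finset.Nat.antidiagonalTuple (m + 1) n, f l =
      ∑ p ∈ Finset.HasAntidiagonal.antidiagonal n,
        ∑ l ∈ Finset.Nat.antidiagonalTuple m p.2, f (Fin.cons p.1 l) := by
  rw [Finset.sum_sigma']
  symm
  refine Finset.sum_bij' (fun x _ => Fin.cons x.1.1 x.2)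
    (fun l _ => ⟨(l 0, ∑ i : Fin m, l i.succ), fun i => l i.succ⟩) ?_ ?_ ?_ ?_ ?_
  · rintro ⟨⟨a, b⟩, l⟩ h
    simp only [Finset.mem_sigma, Finset.HasAntidiagonal.mem_antidiagonal,
      Finset.Nat.mem_antidiagonalTuple] at h ⊢
    rw [Fin.sum_cons, h.2, h.1]
  · intro l h
    simp only [Finset.mem_sigma, Finset.HasAntidiagonal.mem_antidiagonal,
      Finset.Nat.mem_antidiagonalTuple] at h ⊢
    exact ⟨by rw [← h, Fin.sum_univ_succ], trivial⟩
  · rintro ⟨⟨a, b⟩, l⟩ h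
    simp only [Finset.mem_sigma, Finset.HasAntidiagonal.mem_antidiagonal,
      Finset.Nat.mem_antidiagonalTuple] at h
    obtain ⟨-, rfl⟩ := h
    simp
  · intro l _
    exact Fin.cons_self_tail l
  · intros
    rfl

lemma sum_antidiagonal_inv_mul_inv (n : ℕ) :
    ∑ p ∈ Finset.HasAntidiagonal.antidiagonal n, ((p.1 : ℝ) + 1)⁻¹ * ((p.2 : ℝ) + 1)⁻¹ =
      2 * (harmonic (n + 1) : ℝ) / (n + 2) := by
  have hfst : ∑ p ∈ Finset.HasAntidiagonal.antidiagonal n, ((p.1 : ℝ) + 1)⁻¹ = (harmonic (n + 1) : ℝ) := by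
    rw [Finset.Nat.sum_antidiagonal_eq_sum_range_succ_mk]
    simp [harmonic]
  have hsnd : ∑ p ∈ Finset.HasAntidiagonal.antidiagonal n, ((p.2 : ℝ) + 1)⁻¹ = (harmonic (n + 1) : ℝ) := by
    rw [← hfst]
    exact Finset.Nat.sum_antidiagonal_swap (f := fun p : ℕ × ℕ => ((p.1 : ℝ) + 1)⁻¹)
  calc
    _ = ∑ p ∈ Finset.HasAntidiagonal.antidiagonal n,
          (((p.1 : ℝ) + 1)⁻¹ + ((p.2 : ℝ) + 1)⁻¹) / (n + 2) := by
      refine Finset.sum_congr rfl fun p hp => ?_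
      rw [← Finset.HasAntidiagonal.mem_antidiagonal.mp hp]
      push_cast
      have h₁ : (p.1 : ℝ) + 1 ≠ 0 := by positivity
      have h₂ : (p.2 : ℝ) + 1 ≠ 0 := by positivity
      have h₃ : (p.1 : ℝ) + p.2 + 2 ≠ 0 := by positivity
      field_simp
      ring
    _ = _ := by
      rw [← Finset.sum_div, Finset.sum_add_distrib, hfst, hsnd, two_mul]

lemma sum_antidiagonalTuple_prod_inv_le (m n : ℕ) :
    ∑ l ∈ Finset.Nat.antidiagonalTuple m n, ∏ i, ((l i : ℝ) + 1)⁻¹ ≤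
      (2 * (harmonic (n + 1) : ℝ)) ^ m / (n + 1) := by
  have hmono : Monotone fun n : ℕ => (harmonic n : ℝ) := by
    refine monotone_nat_of_le_succ fun n => ?_
    rw [harmonic_succ]
    push_cast
    exact le_add_of_nonneg_right (by positivity)
  have hnonneg (n : ℕ) : 0 ≤ (harmonic n : ℝ) := by
    simpa using hmono (Nat.zero_le n)
  induction m generalizing n with
  | zero =>
    cases n with
    | zero => simp
    | succ n =>
      simp only [Finset.Nat.antidiagonalTuple_zero_succ, Finset.sum_empty]
      positivity
  | succ m ih =>
    rw [sum_antidiagonalTuple_succ]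
    simp only [Fin.prod_univ_succ, Fin.cons_zero, Fin.cons_succ, ← Finset.mul_sum]
    calc
      _ ≤ ∑ p ∈ Finset.HasAntidiagonal.antidiagonal n, (2 * (harmonic (n + 1) : ℝ)) ^ m *
            (((p.1 : ℝ) + 1)⁻¹ * ((p.2 : ℝ) + 1)⁻¹) := by
        refine Finset.sum_le_sum fun p hp => ?_
        have hle : p.2 + 1 ≤ n + 1 := by
          have := Finset.HasAntidiagonal.mem_antidiagonal.mp hp
          omega
        calc
          _ ≤ ((p.1 : ℝ) + 1)⁻¹ * ((2 * (harmonic (p.2 + 1) : ℝ)) ^ m / (p.2 + 1)) :=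
            mul_le_mul_of_nonneg_left (ih p.2) (by positivity)
          _ ≤ ((p.1 : ℝ) + 1)⁻¹ * ((2 * (harmonic (n + 1) : ℝ)) ^ m / (p.2 + 1)) := by
            have h₁ := hmono hle
            have h₂ := hnonneg (p.2 + 1)
            dsimp only at h₁
            gcongr
          _ = _ := by ring
      _ = (2 * (harmonic (n + 1) : ℝ)) ^ (m + 1) / (n + 2) := by
        rw [← Finset.mul_sum, sum_antidiagonal_inv_mul_inv, pow_succ]
        ring
      _ ≤ _ := by
        have := hnonneg (n + 1)
        gcongr
        norm_num

lemma harmonic_pow_div_le (m n : ℕ) :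
    (harmonic (n + 1) : ℝ) ^ m / (n + 1) ≤ m.factorial * Real.exp 1 := by
  have hpos : (0 : ℝ) < n + 1 := by positivity
  have hharm : (harmonic (n + 1) : ℝ) ≤ 1 + Real.log (n + 1) := by
    exact_mod_cast harmonic_le_one_add_log (n + 1)
  have hnonneg : 0 ≤ (harmonic (n + 1) : ℝ) := by
    exact_mod_cast (harmonic_pos n.succ_ne_zero).le
  rw [div_le_iff₀ hpos]
  calc
    (harmonic (n + 1) : ℝ) ^ m ≤ m.factorial * Real.exp (harmonic (n + 1)) := by
      rw [mul_comm, ← div_le_iff₀ (by positivity)]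
      exact Real.pow_div_factorial_le_exp _ hnonneg m
    _ ≤ m.factorial * Real.exp (1 + Real.log (n + 1)) := by gcongr
    _ = m.factorial * Real.exp 1 * (n + 1) := by
      rw [Real.exp_add, Real.exp_log hpos, mul_assoc]

/-- the combinatorial sum estimate in the proof of Lemma 4.5:
`Σ_{l₁+⋯+l_k = j-1} 1/((l₁+1)²(l₂+1)⋯(l_k+1)) ≤ C` uniformly in `j ≥ 1`. -/
theorem combinatorial_sum_bounded
    (k : ℕ) (hk : 2 ≤ k) :
    ∃ C : ℝ, 0 < C ∧ ∀ j : ℕ, 1 ≤ j →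
      ∑ l ∈ Finset.Nat.antidiagonalTuple k (j - 1),
        (1 : ℝ) / (((l ⟨0, by omega⟩ : ℕ) + 1 : ℝ) ^ 2 *
          ∏ i ∈ Finset.univ.erase (⟨0, by omega⟩ : Fin k), ((l i : ℕ) + 1 : ℝ)) ≤ C := by
  refine ⟨2 ^ k * (k.factorial * Real.exp 1), by positivity, fun j _ => ?_⟩
  calc
    _ ≤ ∑ l ∈ Finset.Nat.antidiagonalTuple k (j - 1), ∏ i, ((l i : ℝ) + 1)⁻¹ := by
      refine Finset.sum_le_sum fun l _ => ?_
      rw [Finset.prod_inv_distrib, ← one_div,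
        ← Finset.mul_prod_erase _ _ (Finset.mem_univ (⟨0, by omega⟩ : Fin k))]
      gcongr
      exact le_self_pow₀ (le_add_of_nonneg_left (Nat.cast_nonneg _)) two_ne_zero
    _ ≤ (2 * (harmonic (j - 1 + 1) : ℝ)) ^ k / ((j - 1 : ℕ) + 1) :=
      sum_antidiagonalTuple_prod_inv_le k (j - 1)
    _ ≤ _ := by
      rw [mul_pow, mul_div_assoc]
      gcongr
      exact harmonic_pow_div_le k (j - 1)

end
end
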